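/- arXiv:2306.01994 — 2 statements merged into one kernel-verified Lean document; each statement's English description precedes it below -/
import Mathlib

section
/- Let (Γ, x_0) be a perfect rooted tree of height h ≥ 1 and t = h+1. Then for all s ≥ 1, reg(R/I_t(Γ)^s) = t(s−1) + 1 + Σ_{x : 0 ≤ ℓ(x) ≤ h−2} deg⁺(x) = t(s−1) + reg(R/I_t(Γ)). -/
open MvPolynomial

structure MinFreeRes (k σ : Type) [Field k] (I : Ideal (MvPolynomial σ k)) where
  b : ℕ → ℕ
  deg : (i : ℕ) → Fin (b i) → ℕ
  d : (i : ℕ) → ((Fin (b (i + 1)) → MvPolynomial σ k) →ₗ[MvPolynomial σ k]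
        (Fin (b i) → MvPolynomial σ k))
  aug : (Fin (b 0) → MvPolynomial σ k) →ₗ[MvPolynomial σ k] (MvPolynomial σ k ⧸ I)
  aug_surjective : Function.Surjective aug
  exact_zero : Function.Exact (d 0) aug
  exact_succ : ∀ i : ℕ, Function.Exact (d (i + 1)) (d i)
  aug_homog : ∀ j : Fin (b 0), ∃ p : MvPolynomial σ k,
      p.IsHomogeneous (deg 0 j) ∧ aug (Pi.single j 1) = Ideal.Quotient.mk I p
  d_homog : ∀ (i : ℕ) (j : Fin (b (i + 1))) (l : Fin (b i)),
      (d i (Pi.single j 1) l).IsHomogeneous (deg (i + 1) j - deg i l) ∧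
        (deg (i + 1) j < deg i l → d i (Pi.single j 1) l = 0)
  minimal : ∀ (i : ℕ) (j : Fin (b (i + 1))) (l : Fin (b i)),
      MvPolynomial.constantCoeff (d i (Pi.single j 1) l) = 0

/-- The Castelnuovo-Mumford regularity of the module `R/I`, defined as the supremum of
`j - i` over the nonzero graded Betti numbers `β_{i,j}(R/I)`, read off from (any)
minimal graded free resolution of `R/I`. -/
noncomputable def reg (k σ : Type) [Field k] (I : Ideal (MvPolynomial σ k)) : ℤ :=
  sSup {x : ℤ | ∃ F : MinFreeRes k σ I, ∃ i : ℕ, ∃ j : Fin (F.b i), x = (F.deg i j : ℤ) - i}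

/-- A rooted tree on the vertex set `V`, encoded by the parent function (every edge is
directed away from the root). -/
structure RTree (V : Type) where
  root : V
  parent : V → V
  parent_root : parent root = root
  reach : ∀ v : V, ∃ n : ℕ, parent^[n] v = root

namespace RTree

variable {V : Type} [Fintype V] [DecidableEq V]

/-- The level of a vertex: its distance from the root. -/
noncomputable def level (T : RTree V) (v : V) : ℕ := Nat.find (T.reach v)

/-- The height of the rooted tree: the maximal level of a vertex. -/
noncomputable def height (T : RTree V) : ℕ := Finset.univ.sup fun v => T.level v

/-- The outdegree of a vertex: its number of children. -/
noncomputable def outdeg (T : RTree V) (x : V) : ℕ :=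
  Nat.card {y : V // T.parent y = x ∧ y ≠ T.root}

/-- A leaf is a vertex with no children. -/
def IsLeaf (T : RTree V) (x : V) : Prop := ∀ y : V, T.parent y = x → y = T.root

/-- A rooted tree is perfect if every leaf has level equal to the height. -/
def Perfect (T : RTree V) : Prop := ∀ x : V, T.IsLeaf x → T.level x = T.height

/-- The monomial of the directed path on `t` vertices ending at `v`
(valid when `level v ≥ t - 1`). -/
noncomputable def pathMonomial (T : RTree V) (k : Type) [Field k] (t : ℕ) (v : V) :
    MvPolynomial V k := ∏ j ∈ Finset.range t, MvPolynomial.X (T.parent^[j] v)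

/-- The `t`-path ideal `I_t(Γ)`: generated by the monomials of directed paths on
`t` vertices. -/
noncomputable def pathIdeal (T : RTree V) (k : Type) [Field k] (t : ℕ) :
    Ideal (MvPolynomial V k) :=
  Ideal.span {m | ∃ v : V, t ≤ T.level v + 1 ∧ m = T.pathMonomial k t v}

end RTree

set_option linter.unusedSectionVars false
set_option linter.unusedSimpArgs false
set_option linter.unreachableTactic false
set_option linter.unusedTactic false

namespace PK

section koszul
variable {V : Type} [Fintype V] [DecidableEq V]

/-- An auxiliary linear ordering of the vertices. -/
noncomputable def idx (v : V) : ℕ := (Fintype.equivFin V v : ℕ)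

theorem idx_inj {v w : V} (h : idx v = idx w) : v = w :=
  (Fintype.equivFin V).injective (Fin.ext h)

/-- The Koszul sign. -/
noncomputable def eps (v : V) (σ : Finset V) : ℤ :=
  (-1) ^ ((σ.filter (fun w => idx w < idx v)).card)

theorem eps_sq (v : V) (σ : Finset V) : eps v σ * eps v σ = 1 := by
  unfold eps; rw [← pow_add, ← two_mul, pow_mul]; simp

theorem eps_insert_lt {v w : V} {σ : Finset V} (hw : w ∉ σ) (h : idx w < idx v) :
    eps v (insert w σ) = - eps v σ := by
  unfold eps
  rw [Finset.filter_insert, if_pos h, Finset.card_insert_of_notMem (by simp [hw]), pow_succ]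
  ring

theorem eps_insert_not_lt {v w : V} {σ : Finset V} (h : ¬ idx w < idx v) :
    eps v (insert w σ) = eps v σ := by
  unfold eps
  rw [Finset.filter_insert, if_neg h]

theorem eps_anti {v w : V} {σ : Finset V} (hv : v ∉ σ) (hw : w ∉ σ) (hvw : v ≠ w) :
    eps v σ * eps w (insert v σ) = - (eps w σ * eps v (insert w σ)) := by
  rcases lt_trichotomy (idx v) (idx w) with h | h | h
  · rw [eps_insert_lt hv h, eps_insert_not_lt (by omega)]; ring
  · exact absurd (idx_inj h) hvw
  · rw [eps_insert_lt hw h, eps_insert_not_lt (by omega)]; ring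

theorem eps_insert_self {v : V} {σ : Finset V} : eps v (insert v σ) = eps v σ :=
  eps_insert_not_lt (by omega)

variable {M : Type} [AddCommGroup M]

/-- Contraction by a basis vector. -/
noncomputable def iota (v : V) (f : Finset V → M) : Finset V → M :=
  fun σ => if v ∈ σ then 0 else eps v σ • f (insert v σ)

theorem iota_iota_anti (v w : V) (f : Finset V → M) (σ : Finset V) :
    iota v (iota w f) σ + iota w (iota v f) σ = 0 := by
  unfold iota
  by_cases hv : v ∈ σ
  · simp [hv]
  by_cases hw : w ∈ σ
  · simp [hw]
  by_cases hvw : v = w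
  · subst hvw; simp
  have hvw' : w ≠ v := fun h => hvw h.symm
  simp only [hv, hw, if_false, Finset.mem_insert, hvw, hvw', or_self, smul_smul]
  rw [Finset.insert_comm w v, ← add_smul, eps_anti hv hw hvw]
  simp

theorem iota_iota_self (v : V) (f : Finset V → M) (σ : Finset V) :
    iota v (iota v f) σ = 0 := by
  unfold iota
  by_cases hv : v ∈ σ <;> simp [hv]

theorem iota_add (v : V) (f g : Finset V → M) : iota v (f + g) = iota v f + iota v g := by
  funext σ; by_cases h : v ∈ σ <;> simp [iota, h]

theorem iota_sub (v : V) (f g : Finset V → M) : iota v (f - g) = iota v f - iota v g := by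
  funext σ; by_cases h : v ∈ σ <;> simp [iota, h, smul_sub]

variable {k : Type} [Field k] [Module (MvPolynomial V k) M]

/-- The Koszul differential. -/
noncomputable def kd (k : Type) [Field k] [Module (MvPolynomial V k) M] (f : Finset V → M) :
    Finset V → M :=
  fun σ => ∑ v : V, (X v : MvPolynomial V k) • iota v f σ

theorem kd_add (f g : Finset V → M) : kd k (f + g) = kd k f + kd k g := by
  funext σ; simp [kd, iota_add, Finset.sum_add_distrib]

theorem kd_sub (f g : Finset V → M) : kd k (f - g) = kd k f - kd k g := by
  funext σ; simp [kd, iota_sub, smul_sub, Finset.sum_sub_distrib]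

theorem iota_map {M' : Type} [AddCommGroup M'] (φ : M →+ M') (v : V) (f : Finset V → M)
    (σ : Finset V) : iota v (fun τ => φ (f τ)) σ = φ (iota v f σ) := by
  by_cases h : v ∈ σ <;> simp [iota, h]

theorem kd_map {M' : Type} [AddCommGroup M'] [Module (MvPolynomial V k) M']
    (φ : M →ₗ[MvPolynomial V k] M') (f : Finset V → M) (σ : Finset V) :
    kd k (fun τ => φ (f τ)) σ = φ (kd k f σ) := by
  simp only [kd, map_sum, map_smul]
  refine Finset.sum_congr rfl fun v _ => ?_
  congr 1
  exact iota_map φ.toAddMonoidHom v f σ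

theorem iota_sum {α : Type} (s : Finset α) (v : V) (c : α → MvPolynomial V k)
    (F : α → Finset V → M) (σ : Finset V) :
    iota v (fun τ => ∑ a ∈ s, c a • F a τ) σ = ∑ a ∈ s, c a • iota v (F a) σ := by
  by_cases h : v ∈ σ
  · simp [iota, h]
  · simp only [iota, h, if_false, Finset.smul_sum]
    refine Finset.sum_congr rfl fun a _ => ?_
    rw [smul_comm]

theorem kd_kd (f : Finset V → M) (σ : Finset V) : kd k (kd k f) σ = 0 := by
  have h1 : kd k (kd k f) σ = ∑ p : V × V, ((X p.1 : MvPolynomial V k) * X p.2) •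
      iota p.1 (iota p.2 f) σ := by
    rw [Fintype.sum_prod_type]
    unfold kd
    refine Finset.sum_congr rfl fun v _ => ?_
    rw [iota_sum, Finset.smul_sum]
    refine Finset.sum_congr rfl fun w _ => ?_
    rw [mul_smul]
  rw [h1]
  refine Finset.sum_involution (fun p _ => p.swap) ?_ ?_ (by simp) (by simp)
  · rintro ⟨v, w⟩ _
    simp only [Prod.swap]
    rw [mul_comm (X w : MvPolynomial V k), ← smul_add, iota_iota_anti, smul_zero]
  · rintro ⟨v, w⟩ _ h h'
    simp only [Prod.swap, Prod.mk.injEq] at h'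
    obtain ⟨rfl, -⟩ := h'
    exact h (by simp [iota_iota_self])

end koszul

section hom
variable {V : Type} [Fintype V] [DecidableEq V] {k : Type} [Field k]

/-- All monomials of `p` lie in `S`. -/
def SIn (S : Set (V →₀ ℕ)) (p : MvPolynomial V k) : Prop := ∀ m, coeff m p ≠ 0 → m ∈ S

theorem coeff_zsm (n : ℤ) (m : V →₀ ℕ) (p : MvPolynomial V k) :
    coeff m (n • p) = n • coeff m p := map_zsmul (coeffAddMonoidHom m) n p

theorem SIn.add {S : Set (V →₀ ℕ)} {p q : MvPolynomial V k} (hp : SIn S p) (hq : SIn S q) :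
    SIn S (p + q) := by
  intro m hm
  by_contra h
  have h1 : coeff m p = 0 := by by_contra h'; exact h (hp m h')
  have h2 : coeff m q = 0 := by by_contra h'; exact h (hq m h')
  simp [h1, h2] at hm

theorem SIn.zero {S : Set (V →₀ ℕ)} : SIn S (0 : MvPolynomial V k) := by
  intro m hm; simp at hm

theorem SIn.neg {S : Set (V →₀ ℕ)} {p : MvPolynomial V k} (hp : SIn S p) : SIn S (-p) := by
  intro m hm; exact hp m (by simpa using hm)

theorem SIn.sub {S : Set (V →₀ ℕ)} {p q : MvPolynomial V k} (hp : SIn S p) (hq : SIn S q) :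
    SIn S (p - q) := by rw [sub_eq_add_neg]; exact hp.add hq.neg

theorem SIn.zsmul {S : Set (V →₀ ℕ)} {p : MvPolynomial V k} (hp : SIn S p) (n : ℤ) :
    SIn S (n • p) := by
  intro m hm
  refine hp m fun h => hm ?_
  rw [coeff_zsm, h, smul_zero]

theorem SIn.sum {S : Set (V →₀ ℕ)} {α : Type} (s : Finset α) {F : α → MvPolynomial V k}
    (h : ∀ a ∈ s, SIn S (F a)) : SIn S (∑ a ∈ s, F a) := by
  intro m hm
  rw [coeff_sum] at hm
  obtain ⟨a, ha, hne⟩ := Finset.exists_ne_zero_of_sum_ne_zero hm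
  exact h a ha m hne

theorem SIn.mono {S T : Set (V →₀ ℕ)} (hST : S ⊆ T) {p : MvPolynomial V k} (hp : SIn S p) :
    SIn T p := fun m hm => hST (hp m hm)

theorem SIn.X_mul {S : Set (V →₀ ℕ)} (hS : IsUpperSet S) {p : MvPolynomial V k} (hp : SIn S p)
    (v : V) : SIn S (X v * p) := by
  intro m hm
  rw [coeff_X_mul'] at hm
  split_ifs at hm with h
  · exact hS tsub_le_self (hp _ hm)
  · exact absurd rfl hm

theorem kd_SIn {S : Set (V →₀ ℕ)} (hS : IsUpperSet S) {f : Finset V → MvPolynomial V k}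
    (hf : ∀ σ, SIn S (f σ)) (σ : Finset V) : SIn S (kd k f σ) := by
  unfold kd
  refine SIn.sum _ fun v _ => ?_
  rw [smul_eq_mul]
  refine SIn.X_mul hS ?_ v
  unfold iota
  split_ifs
  · exact SIn.zero
  · exact (hf _).zsmul _

/-- Division by a variable. -/
noncomputable def Dv (v : V) (p : MvPolynomial V k) : MvPolynomial V k :=
  p.divMonomial (Finsupp.single v 1)

/-- Setting a variable to zero. -/
noncomputable def Pv (v : V) (p : MvPolynomial V k) : MvPolynomial V k :=
  p.modMonomial (Finsupp.single v 1)

theorem coeff_Dv (v : V) (p : MvPolynomial V k) (m : V →₀ ℕ) :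
    coeff m (Dv v p) = coeff (Finsupp.single v 1 + m) p := coeff_divMonomial _ _ _

theorem Pv_add (v : V) (p : MvPolynomial V k) : Pv v p + X v * Dv v p = p :=
  modMonomial_add_divMonomial_single p v

theorem coeff_Pv (v : V) (p : MvPolynomial V k) (m : V →₀ ℕ) :
    coeff m (Pv v p) = if m v = 0 then coeff m p else 0 := by
  split_ifs with h
  · refine coeff_modMonomial_of_not_le _ ?_
    rw [Finsupp.single_le_iff]; omega
  · refine coeff_modMonomial_of_le _ ?_
    rw [Finsupp.single_le_iff]; omega

theorem Dv_sum {α : Type} (s : Finset α) (v : V) (F : α → MvPolynomial V k) :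
    Dv v (∑ a ∈ s, F a) = ∑ a ∈ s, Dv v (F a) := by
  ext m; simp [coeff_Dv, coeff_sum]

theorem Dv_zsmul (v : V) (n : ℤ) (p : MvPolynomial V k) : Dv v (n • p) = n • Dv v p := by
  ext m; rw [coeff_Dv, coeff_zsm, coeff_zsm, coeff_Dv]

theorem Dv_X_self (v : V) (p : MvPolynomial V k) : Dv v (X v * p) = p := by
  ext m; rw [coeff_Dv, coeff_X_mul]

theorem Dv_X_ne {v w : V} (h : w ≠ v) (p : MvPolynomial V k) :
    Dv v (X w * p) = X w * Dv v p := by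
  ext m
  rw [coeff_Dv, coeff_X_mul', coeff_X_mul', coeff_Dv]
  have h1 : w ∈ (Finsupp.single v 1 + m).support ↔ w ∈ m.support := by
    simp [Finsupp.single_apply, h.symm]
  simp only [h1]
  split_ifs with h2
  · congr 1
    ext x
    have : m w ≠ 0 := by simpa using h2
    simp only [Finsupp.tsub_apply, Finsupp.add_apply, Finsupp.single_apply]
    split_ifs <;> first | omega | (subst_vars; first | omega | exact absurd rfl h)
  · rfl

/-- Homotopy operator. -/
noncomputable def sv (v : V) (f : Finset V → MvPolynomial V k) : Finset V → MvPolynomial V k :=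
  fun σ => if v ∈ σ then eps v σ • Dv v (f (σ.erase v)) else 0

theorem homotopy (v : V) (f : Finset V → MvPolynomial V k) (σ : Finset V) :
    f σ - kd k (sv v f) σ - sv v (kd k f) σ = if v ∈ σ then 0 else Pv v (f σ) := by
  by_cases hv : v ∈ σ
  · rw [if_pos hv]
    obtain ⟨ρ, hvρ, rfl⟩ : ∃ ρ, v ∉ ρ ∧ σ = insert v ρ :=
      ⟨σ.erase v, by simp, (Finset.insert_erase hv).symm⟩
    have h1 : sv v (kd k f) (insert v ρ) = ∑ w : V, eps v ρ • Dv v (X w * iota w f ρ) := by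
      simp only [sv, Finset.mem_insert_self, if_true, Finset.erase_insert hvρ, eps_insert_self, kd,
        Dv_sum, Finset.smul_sum, smul_eq_mul]
    have h2 : ∀ w : V, eps v ρ • Dv v (X w * iota w f ρ) + (X w : MvPolynomial V k) •
        iota w (sv v f) (insert v ρ) = if w = v then f (insert v ρ) else 0 := by
      intro w
      by_cases hw : w = v
      · subst hw
        simp only [iota, hvρ, if_false, Finset.mem_insert_self, if_true, smul_zero, add_zero]
        rw [Dv_X_self, smul_smul, eps_sq, one_smul]
      · rw [if_neg hw, Dv_X_ne hw]
        by_cases hwρ : w ∈ ρ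
        · simp [iota, hwρ, Dv]
        · simp only [iota, hwρ, if_false, Finset.mem_insert, hw, or_self, sv, Dv_zsmul, smul_eq_mul,
            true_or, or_true, if_true]
          rw [Finset.insert_comm w v, Finset.erase_insert (by simp [hvρ, Ne.symm hw]),
            eps_insert_self, mul_smul_comm, mul_smul_comm, mul_smul_comm, smul_smul, smul_smul, ← add_smul]
          have := eps_anti hvρ hwρ (Ne.symm hw)
          have h0 : eps v ρ * eps w ρ + eps w (insert v ρ) * eps v (insert w ρ) = 0 := by
            linear_combination (eps v ρ * eps v (insert w ρ)) * this
              - (eps w (insert v ρ) * eps v (insert w ρ)) * eps_sq v ρ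
              - (eps v ρ * eps w ρ) * eps_sq v (insert w ρ)
          rw [h0, zero_smul]
    have h3 : sv v (kd k f) (insert v ρ) + kd k (sv v f) (insert v ρ) = f (insert v ρ) := by
      rw [h1, kd, ← Finset.sum_add_distrib, Finset.sum_congr rfl (fun w _ => h2 w)]
      simp
    rw [← h3]; ring
  · rw [if_neg hv]
    have h1 : sv v (kd k f) σ = 0 := by simp [sv, hv]
    have h2 : kd k (sv v f) σ = X v * Dv v (f σ) := by
      unfold kd
      rw [Finset.sum_eq_single v]
      · simp only [iota, hv, if_false, sv, Finset.mem_insert_self, if_true, Finset.erase_insert hv,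
          eps_insert_self, smul_smul, eps_sq, one_smul, smul_eq_mul]
      · intro w _ hw
        simp only [iota, sv, Finset.mem_insert, Ne.symm hw, hv, or_self, if_false, smul_zero,
          ite_self]
      · simp
    rw [h1, h2]
    nth_rewrite 1 [← Pv_add v (f σ)]
    ring

/-- Monomials divisible by some variable outside `Q`. -/
def offQ (Q : Finset V) : Set (V →₀ ℕ) := {m | ∃ v, v ∉ Q ∧ m v ≠ 0}

theorem offQ_upper (Q : Finset V) : IsUpperSet (offQ Q) := by
  rintro m m' h ⟨v, hv, hm⟩
  exact ⟨v, hv, by have := h v; omega⟩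

theorem koszul_lemma (Q' : Finset V) (Q : Finset V) (hQ : Q' ⊆ Q) (f : Finset V → MvPolynomial V k)
    (hf : ∀ σ, SIn (offQ Q) (kd k f σ)) :
    ∃ g : Finset V → MvPolynomial V k, ∀ σ m, coeff m (f σ - kd k g σ) ≠ 0 →
      m ∈ offQ Q ∨ (coeff m (f σ) ≠ 0 ∧ (∀ v ∈ Q', v ∉ σ ∧ m v = 0)) := by
  induction Q' using Finset.induction_on with
  | empty => exact ⟨0, fun σ m h => Or.inr ⟨by simpa [kd, iota] using h, by simp⟩⟩
  | insert v Q' hv ih =>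
    obtain ⟨g, hg⟩ := ih (fun x hx => hQ (Finset.mem_insert_of_mem hx))
    have hvQ : v ∈ Q := hQ (Finset.mem_insert_self _ _)
    set f' := f - kd k g with hf'
    have hk : kd k f' = kd k f := by
      rw [hf', kd_sub]; funext σ; simp [kd_kd]
    refine ⟨g + sv v f', fun σ m hm => ?_⟩
    have h1 : f σ - kd k (g + sv v f') σ = sv v (kd k f) σ + if v ∈ σ then 0 else Pv v (f' σ) := by
      rw [← homotopy v f' σ, hk, kd_add, hf']
      simp only [Pi.sub_apply, Pi.add_apply]; ring
    rw [h1] at hm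
    by_cases hs : coeff m (sv v (kd k f) σ) = 0
    · rw [coeff_add, hs, zero_add] at hm
      split_ifs at hm with hvσ
      · simp at hm
      · rw [coeff_Pv] at hm
        split_ifs at hm with hmv
        · rcases hg σ m (by simpa [hf'] using hm) with h | ⟨h, h'⟩
          · exact Or.inl h
          · refine Or.inr ⟨h, ?_⟩
            intro w hw
            rcases Finset.mem_insert.1 hw with rfl | hw
            · exact ⟨hvσ, hmv⟩
            · exact h' w hw
        · exact absurd rfl hm
    · left
      unfold sv at hs
      split_ifs at hs with hvσ
      · have h2 : coeff m (Dv v (kd k f (σ.erase v))) ≠ 0 := by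
          intro h; exact hs (by rw [coeff_zsm, h, smul_zero])
        rw [coeff_Dv] at h2
        obtain ⟨w, hw, hmw⟩ := hf _ _ h2
        refine ⟨w, hw, ?_⟩
        have : v ≠ w := by rintro rfl; exact hw hvQ
        simpa [Finsupp.single_apply, this] using hmw
      · simp at hs

end hom
end PK

namespace PK

section grading
variable {V : Type} [Fintype V] [DecidableEq V] {k : Type} [Field k]

/-- Homogeneous of degree `c`, with integer `c`. -/
def hg (c : ℤ) (p : MvPolynomial V k) : Prop := SIn {m | (m.degree : ℤ) = c} p

/-- Component of degree `c`. -/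
noncomputable def comp (c : ℤ) : MvPolynomial V k →+ MvPolynomial V k :=
  if 0 ≤ c then (homogeneousComponent c.toNat).toAddMonoidHom else 0

theorem coeff_comp (c : ℤ) (p : MvPolynomial V k) (m : V →₀ ℕ) :
    coeff m (comp c p) = if (m.degree : ℤ) = c then coeff m p else 0 := by
  unfold comp
  by_cases h : 0 ≤ c
  · rw [if_pos h]
    change coeff m (homogeneousComponent c.toNat p) = _
    rw [coeff_homogeneousComponent]
    have : (m.degree = c.toNat) ↔ ((m.degree : ℤ) = c) := by omega
    simp only [this]
  · rw [if_neg h, if_neg (by omega)]; simp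

theorem comp_hg (c : ℤ) (p : MvPolynomial V k) : hg c (comp c p) := by
  intro m hm
  rw [coeff_comp] at hm
  split_ifs at hm with h
  · exact h
  · exact absurd rfl hm

theorem comp_eq_self {c : ℤ} {p : MvPolynomial V k} (h : hg c p) : comp c p = p := by
  ext m
  rw [coeff_comp]
  split_ifs with h1
  · rfl
  · by_contra h2; exact h1 (h m (Ne.symm h2))

theorem comp_SIn {S : Set (V →₀ ℕ)} {p : MvPolynomial V k} (c : ℤ) (h : SIn S p) :
    SIn S (comp c p) := by
  intro m hm
  rw [coeff_comp] at hm
  split_ifs at hm with h1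
  · exact h m hm
  · exact absurd rfl hm

theorem comp_mul {e : ℤ} {q : MvPolynomial V k} (hq : hg e q) (c : ℤ) (p : MvPolynomial V k) :
    comp c (p * q) = comp (c - e) p * q := by
  ext m
  rw [coeff_comp, coeff_mul, coeff_mul]
  split_ifs with h
  · refine Finset.sum_congr rfl fun x hx => ?_
    rw [coeff_comp]
    by_cases hq0 : coeff x.2 q = 0
    · simp [hq0]
    · have h1 : (x.2.degree : ℤ) = e := hq _ hq0
      have h2 : x.1 + x.2 = m := by simpa using hx
      have h3 : x.1.degree + x.2.degree = m.degree := by rw [← map_add, h2]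
      rw [if_pos (by omega)]
  · symm
    refine Finset.sum_eq_zero fun x hx => ?_
    rw [coeff_comp]
    by_cases hq0 : coeff x.2 q = 0
    · simp [hq0]
    · have h1 : (x.2.degree : ℤ) = e := hq _ hq0
      have h2 : x.1 + x.2 = m := by simpa using hx
      have h3 : x.1.degree + x.2.degree = m.degree := by rw [← map_add, h2]
      rw [if_neg (by omega), zero_mul]

theorem hg_mul {c e : ℤ} {p q : MvPolynomial V k} (hp : hg c p) (hq : hg e q) :
    hg (c + e) (p * q) := by
  have := comp_mul hq (c + e) p
  rw [show c + e - e = c by ring, comp_eq_self hp] at this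
  rw [← this]; exact comp_hg _ _

theorem hg_X (v : V) : hg 1 (X v : MvPolynomial V k) := by
  intro m hm
  rw [coeff_X] at hm
  split_ifs at hm with h
  · subst h; simp
  · exact absurd rfl hm

theorem comp_kd (c : ℤ) (g : Finset V → MvPolynomial V k) (σ : Finset V) :
    kd k (fun τ => comp (c - 1) (g τ)) σ = comp c (kd k g σ) := by
  simp only [kd, map_sum, smul_eq_mul]
  refine Finset.sum_congr rfl fun v _ => ?_
  rw [mul_comm, mul_comm (X v), comp_mul (hg_X v), iota_map]

theorem hg_kd {c : ℤ} {g : Finset V → MvPolynomial V k} (hgg : ∀ σ, hg (c - 1) (g σ))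
    (σ : Finset V) : hg c (kd k g σ) := by
  have h : g = fun τ => comp (c - 1) (g τ) := by
    funext τ; rw [comp_eq_self (hgg τ)]
  rw [h, comp_kd]; exact comp_hg _ _

/-- Vanishing of Koszul homology for the quotient of two monomial modules. -/
def RL (k : Type) [Field k] (U' U : Set (V →₀ ℕ)) (c : ℤ) : Prop :=
  ∀ f : Finset V → MvPolynomial V k, (∀ σ, SIn U' (f σ)) → (∀ σ, hg c (f σ)) →
    (∀ σ, SIn U (kd k f σ)) →
    ∃ g : Finset V → MvPolynomial V k, ∀ σ, SIn U (f σ - kd k g σ)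

theorem RL_trans {U'' U' U : Set (V →₀ ℕ)} {c : ℤ} (hU : U ⊆ U')
    (h1 : RL k U'' U' c) (h2 : RL k U' U c) : RL k U'' U c := by
  intro f hf hc hd
  obtain ⟨g, hg1⟩ := h1 f hf hc (fun σ => (hd σ).mono hU)
  have hg2 : ∀ σ, comp c (f σ - kd k g σ) = f σ - kd k (fun τ => comp (c - 1) (g τ)) σ := by
    intro σ; rw [map_sub, comp_eq_self (hc σ), comp_kd]
  obtain ⟨g', hg'⟩ := h2 (f - kd k (fun τ => comp (c - 1) (g τ)))
    (fun σ => by rw [Pi.sub_apply, ← hg2]; exact comp_SIn _ (hg1 σ))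
    (fun σ => by rw [Pi.sub_apply, ← hg2]; exact comp_hg _ _)
    (fun σ => by rw [kd_sub, Pi.sub_apply, kd_kd, sub_zero]; exact hd σ)
  refine ⟨(fun τ => comp (c - 1) (g τ)) + g', fun σ => ?_⟩
  have := hg' σ
  rw [kd_add, Pi.add_apply, ← sub_sub]
  exact this

/-- Monomial filtrations with linear subquotients. -/
inductive Fil : Finset V → ℕ → Set (V →₀ ℕ) → Prop
  | empty (W : Finset V) (r : ℕ) : Fil W r ∅
  | cell (W : Finset V) (r : ℕ) (Q : Finset V) (u : V → ℕ) (hu : ∑ v ∈ W, u v ≤ r) :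
      Fil W r {m | ∀ v ∈ W, (v ∈ Q → u v ≤ m v) ∧ (v ∉ Q → m v = u v)}
  | ext (W : Finset V) (r : ℕ) (X Y Z : Set (V →₀ ℕ)) (hX : X = Y ∪ Z)
      (hYZ : ∀ z ∈ Z, ∀ y ∈ Y, ¬ z ≤ y) (hY : Fil W r Y) (hZ : Fil W r Z) : Fil W r X

theorem Fil.mono {W : Finset V} {r : ℕ} {X : Set (V →₀ ℕ)} (h : Fil W r X) {r' : ℕ} (hr : r ≤ r') :
    Fil W r' X := by
  induction h with
  | empty => exact Fil.empty _ _
  | cell Q u hu => exact Fil.cell _ _ _ _ (hu.trans hr)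
  | ext X Y Z hX hYZ _ _ h1 h2 => exact Fil.ext _ _ X Y Z hX hYZ h1 h2

theorem Fil.cell_prod {W W' : Finset V} {r r' : ℕ} {Y : Set (V →₀ ℕ)} (hW : Disjoint W W')
    (Q : Finset V) (u : V → ℕ) (hu : ∑ v ∈ W, u v ≤ r) (h' : Fil W' r' Y) :
    Fil (W ∪ W') (r + r')
      ({m | ∀ v ∈ W, (v ∈ Q → u v ≤ m v) ∧ (v ∉ Q → m v = u v)} ∩ Y) := by
  induction h' with
  | empty => rw [Set.inter_empty]; exact Fil.empty _ _
  | cell Q' u' hu' =>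
    have hdis := Finset.disjoint_left.1 hW
    have := Fil.cell (W ∪ W') (r + r') ((W ∩ Q) ∪ (W' ∩ Q')) (fun v => if v ∈ W then u v else u' v) (by
      rw [Finset.sum_union hW]
      refine add_le_add ?_ ?_
      · rwa [Finset.sum_congr rfl (fun v hv => if_pos hv)]
      · rwa [Finset.sum_congr rfl (fun v hv => if_neg (fun h => hdis h hv))])
    convert this using 1
    ext m
    simp only [Set.mem_inter_iff, Set.mem_ofPred_eq, Finset.mem_union, Finset.mem_inter]
    constructor
    · rintro ⟨h1, h2⟩ v hv
      by_cases hvW : v ∈ W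
      · have := h1 v hvW; have := hdis hvW; simp_all
      · have := h2 v (by tauto); simp_all
    · intro h
      refine ⟨fun v hv => ?_, fun v hv => ?_⟩
      · have := h v (Or.inl hv); have := hdis hv; simp_all
      · have := h v (Or.inr hv); have : v ∉ W := fun h => hdis h hv
        simp_all
  | ext X Y Z hX hYZ _ _ h1 h2 =>
    refine Fil.ext _ _ _ _ _ ?_ ?_ h1 h2
    · rw [hX, Set.inter_union_distrib_left]
    · intro z hz y hy; exact hYZ z hz.2 y hy.2

theorem Fil.prod {W W' : Finset V} {r r' : ℕ} {X Y : Set (V →₀ ℕ)} (hW : Disjoint W W')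
    (h : Fil W r X) (h' : Fil W' r' Y) : Fil (W ∪ W') (r + r') (X ∩ Y) := by
  induction h with
  | empty => rw [Set.empty_inter]; exact Fil.empty _ _
  | cell Q u hu => exact Fil.cell_prod hW Q u hu h'
  | ext X Y' Z hX hYZ _ _ h1 h2 =>
    refine Fil.ext _ _ _ _ _ ?_ ?_ h1 h2
    · rw [hX, Set.union_inter_distrib_right]
    · intro z hz y hy; exact hYZ z hz.1 y hy.1

theorem Fil.univ (W : Finset V) : Fil W 0 Set.univ := by
  have := Fil.cell W 0 Finset.univ (fun _ => 0) (by simp)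
  convert this using 1
  ext m; simp

theorem Fil.enlarge {W W' : Finset V} {r : ℕ} {X : Set (V →₀ ℕ)} (h : Fil W r X) (hW : W ⊆ W') :
    Fil W' r X := by
  have := Fil.prod (Finset.disjoint_sdiff (s := W) (t := W')) h (Fil.univ (W' \ W))
  rwa [Finset.union_sdiff_of_subset hW, Set.inter_univ, add_zero] at this

theorem Fil.slice {W : Finset V} {r : ℕ} (X : Set (V →₀ ℕ)) (x : (V →₀ ℕ) → ℕ) (hx : Monotone x)
    (a : ℕ) (h : ∀ j < a, Fil W r ({m | x m = j} ∩ X)) (h' : Fil W r ({m | a ≤ x m} ∩ X)) :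
    Fil W r X := by
  have key : ∀ i ≤ a, Fil W r ({m | a - i ≤ x m} ∩ X) := by
    intro i
    induction i with
    | zero => intro _; simpa using h'
    | succ i ih =>
      intro hi
      refine Fil.ext _ _ _ _ _ ?_ ?_ (h (a - (i + 1)) (by omega)) (ih (by omega))
      · rw [← Set.union_inter_distrib_right]
        congr 1
        ext m
        simp only [Set.mem_union, Set.mem_ofPred_eq]
        omega
      · rintro z ⟨hz, -⟩ y ⟨hy, -⟩ hzy
        have := hx hzy
        simp only [Set.mem_ofPred_eq] at hz hy
        omega
  have := key a le_rfl
  simpa using this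

theorem cell_RL (r : ℕ) (Q : Finset V) (u : V → ℕ) (hu : ∑ v, u v ≤ r)
    (U : Set (V →₀ ℕ)) (hU : IsUpperSet U) {X : Set (V →₀ ℕ)}
    (hX : X = {m | ∀ v, (v ∈ Q → u v ≤ m v) ∧ (v ∉ Q → m v = u v)})
    (hUX : IsUpperSet (U ∪ X)) (hd : Disjoint U X) (c : ℤ) (hc : (r : ℤ) < c) :
    RL k (U ∪ X) U c := by
  intro f hf hfc hfd
  set u' : V →₀ ℕ := Finsupp.equivFunOnFinite.symm u with hu'
  have hu'v : ∀ v, u' v = u v := fun v => by simp [hu']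
  have hdeg : u'.degree ≤ r := by
    rw [Finsupp.degree_eq_sum]; simpa [hu'v] using hu
  have hu'X : u' ∈ X := by rw [hX]; intro v; simp [hu'v]
  have hge : ∀ m ∈ X, u' ≤ m := by
    intro m hm v
    rw [hX] at hm
    rw [hu'v]
    by_cases h : v ∈ Q
    · exact (hm v).1 h
    · exact ((hm v).2 h).ge
  have hXoff : ∀ m, u' + m ∈ X ↔ m ∉ offQ Q := by
    intro m
    rw [hX]
    simp only [offQ, Set.mem_ofPred_eq, not_exists, not_and, not_not, Finsupp.add_apply, hu'v]
    constructor
    · intro h v hv; have := (h v).2 hv; omega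
    · intro h v; exact ⟨fun _ => by omega, fun hv => by rw [h v hv]; rfl⟩
  have hoffU : ∀ m ∈ offQ Q, u' + m ∈ U := by
    intro m hm
    have : u' + m ∈ U ∪ X := hUX (a := u') (by simp) (Or.inr hu'X)
    rcases this with h | h
    · exact h
    · exact absurd hm ((hXoff m).1 h)
  let h : Finset V → MvPolynomial V k := fun σ => (f σ).divMonomial u'
  have hcoeff : ∀ σ m, coeff m (h σ) = coeff (u' + m) (f σ) := fun σ m => coeff_divMonomial _ _ _
  let μ : MvPolynomial V k →ₗ[MvPolynomial V k] MvPolynomial V k :=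
    LinearMap.mulLeft _ (monomial u' 1)
  have hμ : ∀ p m, coeff (u' + m) (μ p) = coeff m p := by
    intro p m
    simp only [μ, LinearMap.mulLeft_apply, coeff_monomial_mul, one_mul]
  have hμ' : ∀ p m, coeff m (μ p) ≠ 0 → ∃ m', m = u' + m' ∧ coeff m' p ≠ 0 := by
    intro p m hm
    simp only [μ, LinearMap.mulLeft_apply, coeff_monomial_mul'] at hm
    split_ifs at hm with hle
    · exact ⟨m - u', (add_tsub_cancel_of_le hle).symm, by simpa using hm⟩
    · exact absurd rfl hm
  have hl : ∀ σ, SIn U (f σ - μ (h σ)) := by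
    intro σ m hm
    by_cases hle : u' ≤ m
    · obtain ⟨m', rfl⟩ := exists_add_of_le hle
      rw [coeff_sub, hμ, hcoeff, sub_self] at hm
      exact absurd rfl hm
    · have h0 : coeff m (μ (h σ)) = 0 := by
        by_contra h1
        obtain ⟨m', rfl, -⟩ := hμ' _ _ h1
        exact hle (by simp)
      rw [coeff_sub, h0, sub_zero] at hm
      rcases hf σ m hm with h2 | h2
      · exact h2
      · exact absurd (hge m h2) hle
  have hkd : ∀ σ, SIn (offQ Q) (kd k h σ) := by
    intro σ m hm
    by_contra hoff
    have h1 : SIn U (μ (kd k h σ)) := by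
      rw [← kd_map]
      have e : (fun τ => μ (h τ)) = f - (f - fun τ => μ (h τ)) := by abel
      rw [e, kd_sub, Pi.sub_apply]
      exact (hfd σ).sub (kd_SIn hU hl σ)
    have h2 : u' + m ∈ U := h1 _ (by rw [hμ]; exact hm)
    exact Set.disjoint_left.1 hd h2 ((hXoff m).2 hoff)
  obtain ⟨g, hg⟩ := koszul_lemma Q Q (le_refl _) h hkd
  refine ⟨fun τ => μ (g τ), fun σ => ?_⟩
  have e : f σ - kd k (fun τ => μ (g τ)) σ = (f σ - μ (h σ)) + μ (h σ - kd k g σ) := by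
    rw [kd_map, map_sub]; ring
  rw [e]
  refine (hl σ).add ?_
  intro m hm
  obtain ⟨m', rfl, hm'⟩ := hμ' _ _ hm
  refine hoffU m' ?_
  rcases hg σ m' hm' with h1 | ⟨h1, h2⟩
  · exact h1
  · rw [hcoeff] at h1
    have h3 : ((u' + m').degree : ℤ) = c := hfc σ _ h1
    have h4 : m' ≠ 0 := by
      rintro rfl
      rw [add_zero] at h3; omega
    obtain ⟨v, hv⟩ := Finsupp.ne_iff.1 h4
    exact ⟨v, fun hvQ => hv (h2 v hvQ).2, hv⟩

theorem Fil_RL {r : ℕ} {X : Set (V →₀ ℕ)} (h : Fil Finset.univ r X)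
    (U : Set (V →₀ ℕ)) (hU : IsUpperSet U)
    (hUX : IsUpperSet (U ∪ X)) (hd : Disjoint U X) (c : ℤ) (hc : (r : ℤ) < c) :
    RL k (U ∪ X) U c := by
  generalize hW : (Finset.univ : Finset V) = W at h
  induction h generalizing U with
  | empty =>
    intro f hf _ _
    exact ⟨0, fun σ => by simpa [kd, iota] using hf σ⟩
  | cell Q u hu =>
    subst hW
    exact cell_RL r Q u hu U hU (by ext m; simp) hUX hd c hc
  | ext X Y Z hX hYZ _ _ h1 h2 =>
    subst hX
    have hUZ : IsUpperSet (U ∪ Z) := by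
      intro a b hab ha
      have hb : b ∈ U ∪ (Y ∪ Z) := hUX hab (by rcases ha with h | h <;> simp [h])
      rcases ha with ha | ha
      · exact Or.inl (hU hab ha)
      · rcases hb with hb | hb | hb
        · exact Or.inl hb
        · exact absurd hab (hYZ a ha b hb)
        · exact Or.inr hb
    have e : U ∪ (Y ∪ Z) = (U ∪ Z) ∪ Y := by
      rw [Set.union_comm Y Z, Set.union_assoc]
    have hYZd : Disjoint Z Y := by
      rw [Set.disjoint_left]
      intro z hz hy; exact hYZ z hz z hy le_rfl
    rw [Set.disjoint_union_right] at hd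
    have r1 := h1 (U ∪ Z) hUZ (by rw [← e]; exact hUX)
      (by rw [Set.disjoint_union_left]; exact ⟨hd.1, hYZd⟩)
    have r2 := h2 U hU hUZ hd.2
    rw [e]
    exact RL_trans Set.subset_union_left r1 r2

end grading
end PK

namespace PK

section res
variable {V : Type} [Fintype V] [DecidableEq V] {k : Type} [Field k]

/-- Homogeneous elements of a graded free module. -/
def gF {b : ℕ} (deg : Fin b → ℕ) (c : ℤ) (f : Fin b → MvPolynomial V k) : Prop :=
  ∀ l, hg (c - deg l) (f l)

/-- Homogeneous component in a graded free module. -/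
noncomputable def compF {b : ℕ} (deg : Fin b → ℕ) (c : ℤ) (f : Fin b → MvPolynomial V k) :
    Fin b → MvPolynomial V k := fun l => comp (c - deg l) (f l)

theorem compF_gF {b : ℕ} (deg : Fin b → ℕ) (c : ℤ) (f : Fin b → MvPolynomial V k) :
    gF deg c (compF deg c f) := fun _ => comp_hg _ _

theorem compF_eq_self {b : ℕ} {deg : Fin b → ℕ} {c : ℤ} {f : Fin b → MvPolynomial V k}
    (h : gF deg c f) : compF deg c f = f := funext fun l => comp_eq_self (h l)

theorem lin_apply {b' b : ℕ} (d : (Fin b' → MvPolynomial V k) →ₗ[MvPolynomial V k]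
    (Fin b → MvPolynomial V k)) (f : Fin b' → MvPolynomial V k) (l : Fin b) :
    d f l = ∑ j, f j * d (Pi.single j 1) l := by
  have h : f = ∑ j, f j • (Pi.single j 1 : Fin b' → MvPolynomial V k) := by
    funext i; simp [Finset.sum_apply, Pi.single_apply]
  conv_lhs => rw [h]
  simp [map_sum, Finset.sum_apply]

theorem compF_lin {b' b : ℕ} {deg' : Fin b' → ℕ} {deg : Fin b → ℕ}
    (d : (Fin b' → MvPolynomial V k) →ₗ[MvPolynomial V k] (Fin b → MvPolynomial V k))
    (hd : ∀ j l, hg ((deg' j : ℤ) - deg l) (d (Pi.single j 1) l)) (c : ℤ)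
    (f : Fin b' → MvPolynomial V k) : d (compF deg' c f) = compF deg c (d f) := by
  funext l
  simp only [compF]
  rw [lin_apply, lin_apply d f, map_sum]
  refine Finset.sum_congr rfl fun j _ => ?_
  rw [comp_mul (hd j l), show c - deg l - ((deg' j : ℤ) - deg l) = c - deg' j by ring]
  rfl

theorem kd_coord {b : ℕ} (f : Finset V → Fin b → MvPolynomial V k) (σ : Finset V) (l : Fin b) :
    kd k f σ l = kd k (fun τ => f τ l) σ :=
  (kd_map (LinearMap.proj l) f σ).symm

theorem constCoeff_kd (f : Finset V → MvPolynomial V k) (σ : Finset V) :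
    constantCoeff (kd k f σ) = 0 := by
  simp [kd, map_sum]

theorem acyc1 (f : Finset V → MvPolynomial V k) (h : ∀ σ, kd k f σ = 0)
    (h0 : constantCoeff (f ∅) = 0) : ∃ g : Finset V → MvPolynomial V k, ∀ σ, kd k g σ = f σ := by
  obtain ⟨g, hg⟩ := koszul_lemma Finset.univ Finset.univ le_rfl f
    (fun σ => by rw [h]; exact SIn.zero)
  refine ⟨g, fun σ => ?_⟩
  symm
  rw [← sub_eq_zero]
  ext m
  rw [coeff_zero]
  by_contra hne
  rcases hg σ m hne with h1 | ⟨h1, h2⟩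
  · obtain ⟨v, hv, _⟩ := h1; simp at hv
  · have hm : m = 0 := Finsupp.ext fun v => (h2 v (Finset.mem_univ v)).2
    have hs : σ = ∅ := Finset.eq_empty_of_forall_notMem fun v => (h2 v (Finset.mem_univ v)).1
    subst hm; subst hs
    exact h1 h0

theorem acyc {b : ℕ} (f : Finset V → Fin b → MvPolynomial V k) (h : ∀ σ, kd k f σ = 0)
    (h0 : ∀ l, constantCoeff (f ∅ l) = 0) :
    ∃ g : Finset V → Fin b → MvPolynomial V k, ∀ σ, kd k g σ = f σ := by
  have : ∀ l, ∃ g : Finset V → MvPolynomial V k, ∀ σ, kd k g σ = f σ l := fun l =>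
    acyc1 (fun τ => f τ l) (fun σ => by rw [← kd_coord, h]; rfl) (h0 l)
  choose g hg using this
  refine ⟨fun τ l => g l τ, fun σ => funext fun l => ?_⟩
  rw [kd_coord]; exact hg l σ

theorem kd_trunc {M : Type} [AddCommGroup M] [Module (MvPolynomial V k) M] (a : ℕ)
    (g : Finset V → M) (σ : Finset V) :
    kd k (fun τ => if τ.card = a + 1 then g τ else 0) σ = if σ.card = a then kd k g σ else 0 := by
  unfold kd
  split_ifs with h
  · refine Finset.sum_congr rfl fun v _ => ?_
    congr 1
    by_cases hv : v ∈ σ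
    · simp [iota, hv]
    · simp [iota, hv, h]
  · refine Finset.sum_eq_zero fun v _ => ?_
    by_cases hv : v ∈ σ
    · simp [iota, hv]
    · simp [iota, hv, h]

theorem compF_kd {b : ℕ} (deg : Fin b → ℕ) (c : ℤ) (g : Finset V → Fin b → MvPolynomial V k)
    (σ : Finset V) : kd k (fun τ => compF deg (c - 1) (g τ)) σ = compF deg c (kd k g σ) := by
  funext l
  rw [kd_coord]
  simp only [compF]
  rw [kd_coord, ← comp_kd]
  congr 1; funext τ; congr 2; ring

theorem gF_kd {b : ℕ} {deg : Fin b → ℕ} {c : ℤ} {g : Finset V → Fin b → MvPolynomial V k}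
    (h : ∀ σ, gF deg (c - 1) (g σ)) (σ : Finset V) : gF deg c (kd k g σ) := by
  have : g = fun τ => compF deg (c - 1) (g τ) := funext fun τ => (compF_eq_self (h τ)).symm
  rw [this, compF_kd]; exact compF_gF _ _ _

theorem gF_zero {b : ℕ} (deg : Fin b → ℕ) (c : ℤ) :
    gF deg c (0 : Fin b → MvPolynomial V k) := fun _ => SIn.zero

theorem acyc_gr {b : ℕ} {deg : Fin b → ℕ} {c : ℤ} {a : ℕ}
    (f : Finset V → Fin b → MvPolynomial V k) (h : ∀ σ, kd k f σ = 0)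
    (h0 : ∀ l, constantCoeff (f ∅ l) = 0) (hs : ∀ σ, σ.card ≠ a → f σ = 0)
    (hc : ∀ σ, gF deg (c + 1) (f σ)) :
    ∃ g : Finset V → Fin b → MvPolynomial V k, (∀ σ, kd k g σ = f σ) ∧
      (∀ σ, σ.card ≠ a + 1 → g σ = 0) ∧ ∀ σ, gF deg c (g σ) := by
  obtain ⟨g, hg⟩ := acyc f h h0
  refine ⟨fun τ => if τ.card = a + 1 then compF deg c (g τ) else 0, fun σ => ?_, fun σ h => ?_,
    fun σ => ?_⟩
  · rw [kd_trunc a (fun τ => compF deg c (g τ))]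
    split_ifs with h
    · have := compF_kd deg (c + 1) g σ
      rw [show c + 1 - 1 = c by ring] at this
      rw [this, hg, compF_eq_self (hc σ)]
    · exact (hs σ h).symm
  · simp [h]
  · dsimp only
    split_ifs
    · exact compF_gF _ _ _
    · exact gF_zero _ _

/-- Vanishing of a graded piece of Koszul homology of a submodule. -/
def Van {M : Type} [AddCommGroup M] [Module (MvPolynomial V k) M]
    (N : Submodule (MvPolynomial V k) M) (gr : ℤ → M → Prop) (a : ℕ) (c : ℤ) : Prop :=
  ∀ f : Finset V → M, (∀ σ, σ.card ≠ a → f σ = 0) → (∀ σ, f σ ∈ N) → (∀ σ, gr c (f σ)) →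
    (∀ σ, kd k f σ = 0) → ∃ g : Finset V → M, (∀ σ, g σ ∈ N) ∧ ∀ σ, kd k g σ = f σ

section cover
variable {M : Type} [AddCommGroup M] [Module (MvPolynomial V k) M] {b : ℕ} {deg : Fin b → ℕ}
  {gr : ℤ → M → Prop} {φ : (Fin b → MvPolynomial V k) →ₗ[MvPolynomial V k] M}

theorem Van_up (hmap : ∀ c y, gF deg c y → gr c (φ y))
    (hm : ∀ y, φ y = 0 → ∀ l, constantCoeff (y l) = 0) {a : ℕ} {c : ℤ}
    (h : Van (LinearMap.range φ) gr (a + 1) c) : Van (LinearMap.ker φ) (gF deg) a (c + 1) := by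
  intro f hs hN hc hd
  obtain ⟨y, hy, hys, hyc⟩ := acyc_gr f hd (fun l => hm _ (hN ∅) l) hs hc
  obtain ⟨w, hw, hwy⟩ := h (fun σ => φ (y σ)) (fun σ hσ => by rw [hys σ hσ, map_zero])
    (fun σ => ⟨_, rfl⟩) (fun σ => hmap _ _ (hyc σ))
    (fun σ => by rw [kd_map, hy]; exact hN σ)
  choose w' hw' using hw
  refine ⟨y - kd k w', fun σ => ?_, fun σ => ?_⟩
  · have h1 : kd k w σ = φ (kd k w' σ) := by
      rw [← kd_map]; congr 1; funext τ; exact (hw' τ).symm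
    rw [LinearMap.mem_ker, Pi.sub_apply, map_sub, ← h1, hwy, sub_self]
  · rw [kd_sub, Pi.sub_apply, kd_kd, sub_zero, hy]

theorem Van_down (hlift : ∀ c y, gr c (φ y) → ∃ y', gF deg c y' ∧ φ y' = φ y)
    {a : ℕ} {c : ℤ}
    (h : Van (LinearMap.ker φ) (gF deg) a (c + 1)) : Van (LinearMap.range φ) gr (a + 1) c := by
  intro f hs hN hc hd
  have h1 : ∀ σ, ∃ y, gF deg c y ∧ φ y = f σ := by
    intro σ
    obtain ⟨y, hy⟩ := hN σ
    obtain ⟨y', h1, h2⟩ := hlift c y (by rw [hy]; exact hc σ)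
    exact ⟨y', h1, h2.trans hy⟩
  choose f' hf'c hf' using h1
  let f'' : Finset V → Fin b → MvPolynomial V k := fun τ => if τ.card = a + 1 then f' τ else 0
  have hφ : ∀ τ, φ (f'' τ) = f τ := by
    intro τ
    simp only [f'']
    split_ifs with hτ
    · exact hf' τ
    · rw [map_zero, hs τ hτ]
  have hφ' : (fun τ => φ (f'' τ)) = f := funext hφ
  have hc'' : ∀ τ, gF deg (c + 1 - 1) (f'' τ) := by
    intro τ
    rw [show c + 1 - 1 = c by ring]
    simp only [f'']
    split_ifs with hτ
    · exact hf'c τ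
    · exact gF_zero _ _
  obtain ⟨g, hgK, hg⟩ := h (kd k f'')
    (fun σ hσ => by simp only [f'']; rw [kd_trunc, if_neg hσ])
    (fun σ => by rw [LinearMap.mem_ker, ← kd_map, hφ']; exact hd σ)
    (gF_kd hc'') (fun σ => kd_kd _ σ)
  let g0 : Finset V → Fin b → MvPolynomial V k := fun τ => if τ = ∅ then 0 else g τ
  have hg0 : kd k g0 = kd k g := by
    funext σ
    unfold kd
    refine Finset.sum_congr rfl fun v _ => ?_
    congr 1
    simp [iota, g0]
  obtain ⟨w, hw⟩ := acyc (f'' - g0)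
    (fun σ => by rw [kd_sub, Pi.sub_apply, hg0, hg, sub_self])
    (fun l => by simp [f'', g0])
  refine ⟨fun τ => φ (w τ), fun τ => ⟨_, rfl⟩, fun σ => ?_⟩
  rw [kd_map, hw, Pi.sub_apply, map_sub, hφ]
  have : φ (g0 σ) = 0 := by
    simp only [g0]
    split_ifs
    · simp
    · exact hgK σ
  rw [this, sub_zero]

theorem kd_single_empty {N : Type} [AddCommGroup N] [Module (MvPolynomial V k) N] (x : N)
    (σ : Finset V) : kd k (fun τ : Finset V => if τ = ∅ then x else 0) σ = 0 := by
  simp [kd, iota]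

theorem Van_end1 (hmap : ∀ c y, gF deg c y → gr c (φ y)) (hgr0 : ∀ c, gr c 0)
    (hm : ∀ y, φ y = 0 → ∀ l, constantCoeff (y l) = 0) {c : ℤ}
    (h : Van (LinearMap.range φ) gr 0 c) (j : Fin b) (hj : (deg j : ℤ) = c) : False := by
  have hej : gF deg c (Pi.single j 1 : Fin b → MvPolynomial V k) := by
    intro l m hm
    by_cases hl : l = j
    · subst hl
      simp only [Pi.single_eq_same, coeff_one] at hm
      split_ifs at hm with h0
      · subst h0; simp [hj]
      · exact absurd rfl hm
    · simp [Pi.single_eq_of_ne hl] at hm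
  obtain ⟨g, hg1, hg2⟩ := h (fun τ => if τ = ∅ then φ (Pi.single j 1) else 0)
    (fun σ hσ => by
      have : σ ≠ ∅ := by rintro rfl; simp at hσ
      simp [this])
    (fun σ => by split_ifs; exacts [⟨_, rfl⟩, Submodule.zero_mem _])
    (fun σ => by split_ifs; exacts [hmap _ _ hej, hgr0 _])
    (fun σ => kd_single_empty _ _)
  choose g' hg' using hg1
  have h1 : φ (Pi.single j 1 - kd k g' ∅) = 0 := by
    rw [map_sub, ← kd_map, show (fun τ => φ (g' τ)) = g from funext hg', hg2]
    simp
  have h2 := hm _ h1 j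
  rw [Pi.sub_apply, map_sub, kd_coord, constCoeff_kd] at h2
  simp at h2

theorem Van_end2 (hlift : ∀ c y, gr c (φ y) → ∃ y', gF deg c y' ∧ φ y' = φ y) {c : ℤ}
    (h : ∀ j, (deg j : ℤ) ≠ c) : Van (LinearMap.range φ) gr 0 c := by
  intro f hs hN hc hd
  obtain ⟨y, hy⟩ := hN ∅
  obtain ⟨y', h1, h2⟩ := hlift c y (by rw [hy]; exact hc ∅)
  obtain ⟨g, hg⟩ := acyc (fun τ : Finset V => if τ = ∅ then y' else 0)
    (fun σ => kd_single_empty _ _)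
    (fun l => by
      simp only [if_true]
      by_contra hne
      have := h1 l 0 hne
      simp only [Set.mem_ofPred_eq, map_zero, Nat.cast_zero] at this
      exact h l (by omega))
  refine ⟨fun τ => φ (g τ), fun τ => ⟨_, rfl⟩, fun σ => ?_⟩
  rw [kd_map, hg]
  split_ifs with hσ
  · subst hσ; rw [h2, hy]
  · rw [map_zero, hs]; simpa using hσ

end cover

/-- Grading on the quotient. -/
def grI (I : Ideal (MvPolynomial V k)) (c : ℤ) (x : MvPolynomial V k ⧸ I) : Prop :=
  ∃ p, hg c p ∧ Ideal.Quotient.mk I p = x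

/-- Homogeneous ideals. -/
def HomI (I : Ideal (MvPolynomial V k)) : Prop := ∀ c p, p ∈ I → comp c p ∈ I

theorem wt1 (m : V →₀ ℕ) : Finsupp.weight (1 : V → ℕ) m = m.degree := by
  rw [Finsupp.degree_eq_weight_one]; rfl

section chain
variable {I : Ideal (MvPolynomial V k)} (F : MinFreeRes k V I)

theorem d_hg (i : ℕ) (j : Fin (F.b (i + 1))) (l : Fin (F.b i)) :
    hg ((F.deg (i + 1) j : ℤ) - F.deg i l) (F.d i (Pi.single j 1) l) := by
  obtain ⟨h1, h2⟩ := F.d_homog i j l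
  intro m hm
  by_cases h : F.deg (i + 1) j < F.deg i l
  · rw [h2 h] at hm; simp at hm
  · have := h1 hm
    rw [wt1] at this
    simp only [Set.mem_ofPred_eq]
    omega

theorem d_const (i : ℕ) (f : Fin (F.b (i + 1)) → MvPolynomial V k) (l : Fin (F.b i)) :
    constantCoeff (F.d i f l) = 0 := by
  rw [lin_apply, map_sum]
  exact Finset.sum_eq_zero fun j _ => by rw [map_mul, F.minimal, mul_zero]

theorem d_map (i : ℕ) (c : ℤ) (y : Fin (F.b (i + 1)) → MvPolynomial V k)
    (h : gF (F.deg (i + 1)) c y) : gF (F.deg i) c (F.d i y) := by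
  rw [← compF_eq_self h, compF_lin (deg := F.deg i) _ (d_hg F i)]
  exact compF_gF _ _ _

theorem d_lift (i : ℕ) (c : ℤ) (y : Fin (F.b (i + 1)) → MvPolynomial V k)
    (h : gF (F.deg i) c (F.d i y)) : ∃ y', gF (F.deg (i + 1)) c y' ∧ F.d i y' = F.d i y :=
  ⟨compF (F.deg (i + 1)) c y, compF_gF _ _ _, by
    rw [compF_lin (deg := F.deg i) _ (d_hg F i), compF_eq_self h]⟩

theorem d_m (i : ℕ) (y : Fin (F.b (i + 1)) → MvPolynomial V k) (h : F.d i y = 0)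
    (l : Fin (F.b (i + 1))) : constantCoeff (y l) = 0 := by
  obtain ⟨z, rfl⟩ := (F.exact_succ i y).1 h
  exact d_const F _ _ _

theorem aug_m (y : Fin (F.b 0) → MvPolynomial V k) (h : F.aug y = 0) (l : Fin (F.b 0)) :
    constantCoeff (y l) = 0 := by
  obtain ⟨z, rfl⟩ := (F.exact_zero y).1 h
  exact d_const F _ _ _

theorem aug_eq : ∃ P : Fin (F.b 0) → MvPolynomial V k, (∀ j, hg (F.deg 0 j) (P j)) ∧
    ∀ y, F.aug y = Ideal.Quotient.mk I (∑ j, y j * P j) := by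
  choose P hP1 hP2 using F.aug_homog
  refine ⟨P, fun j m hm => ?_, fun y => ?_⟩
  · have := hP1 j hm
    rw [wt1] at this
    simp only [Set.mem_ofPred_eq]; omega
  · have h : y = ∑ j, y j • (Pi.single j 1 : Fin (F.b 0) → MvPolynomial V k) := by
      funext i; simp [Finset.sum_apply, Pi.single_apply]
    conv_lhs => rw [h]
    rw [map_sum, map_sum]
    refine Finset.sum_congr rfl fun j _ => ?_
    rw [map_smul, hP2, map_mul]; rfl

theorem aug_comp {P : Fin (F.b 0) → MvPolynomial V k} (hP : ∀ j, hg (F.deg 0 j) (P j)) (c : ℤ)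
    (y : Fin (F.b 0) → MvPolynomial V k) :
    comp c (∑ j, y j * P j) = ∑ j, compF (F.deg 0) c y j * P j := by
  rw [map_sum]
  exact Finset.sum_congr rfl fun j _ => comp_mul (hP j) c (y j)

theorem aug_map (c : ℤ) (y : Fin (F.b 0) → MvPolynomial V k)
    (h : gF (F.deg 0) c y) : grI I c (F.aug y) := by
  obtain ⟨P, hP, hy⟩ := aug_eq F
  refine ⟨_, ?_, (hy y).symm⟩
  rw [← compF_eq_self h, ← aug_comp F hP]; exact comp_hg _ _

theorem aug_lift (hI : HomI I) (c : ℤ) (y : Fin (F.b 0) → MvPolynomial V k)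
    (h : grI I c (F.aug y)) : ∃ y', gF (F.deg 0) c y' ∧ F.aug y' = F.aug y := by
  obtain ⟨P, hP, hy⟩ := aug_eq F
  obtain ⟨p, hp, hpy⟩ := h
  refine ⟨compF (F.deg 0) c y, compF_gF _ _ _, ?_⟩
  rw [← hpy, hy, ← aug_comp F hP]
  rw [hy] at hpy
  have h1 := hI c _ (Ideal.Quotient.eq.1 hpy)
  rw [map_sub, comp_eq_self hp] at h1
  exact (Ideal.Quotient.eq.2 h1).symm

theorem ker_aug : LinearMap.ker F.aug = LinearMap.range (F.d 0) := by
  ext y; exact F.exact_zero y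

theorem ker_d (i : ℕ) : LinearMap.ker (F.d i) = LinearMap.range (F.d (i + 1)) := by
  ext y; exact F.exact_succ i y

theorem chain_iff (hI : HomI I) (c : ℤ) (j : ℕ) : ∀ i : ℕ,
    Van (LinearMap.range F.aug) (grI I) (i + 1 + j) c ↔
      Van (LinearMap.range (F.d j)) (gF (F.deg j)) i (c + 1 + j) := by
  induction j with
  | zero =>
    intro i
    rw [← ker_aug]
    simp only [add_zero, Nat.cast_zero]
    exact ⟨Van_up (aug_map F) (aug_m F), Van_down (aug_lift F hI)⟩
  | succ j ih =>
    intro i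
    rw [← ker_d, show i + 1 + (j + 1) = (i + 1) + 1 + j by ring, ih (i + 1)]
    rw [show c + 1 + ((j + 1 : ℕ) : ℤ) = (c + 1 + j) + 1 by push_cast; ring]
    exact ⟨Van_up (d_map F j) (d_m F j), Van_down (d_lift F j)⟩

theorem gens_iff (hI : HomI I) (c : ℤ) (i : ℕ) :
    (∃ j : Fin (F.b i), (F.deg i j : ℤ) = c + i) ↔
      ¬ Van (⊤ : Submodule (MvPolynomial V k) (MvPolynomial V k ⧸ I)) (grI I) i c := by
  have htop : LinearMap.range F.aug = ⊤ := LinearMap.range_eq_top.2 F.aug_surjective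
  rw [← htop]
  cases i with
  | zero =>
    simp only [Nat.cast_zero, add_zero]
    constructor
    · rintro ⟨j, hj⟩ h
      exact Van_end1 (aug_map F) (fun c => ⟨0, SIn.zero, by simp⟩) (aug_m F) h j hj
    · intro h
      by_contra hne
      push Not at hne
      exact h (Van_end2 (aug_lift F hI) hne)
  | succ n =>
    have := chain_iff F hI c n 0
    rw [show 0 + 1 + n = n + 1 by ring] at this
    rw [this, show c + ((n + 1 : ℕ) : ℤ) = c + 1 + n by push_cast; ring]
    constructor
    · rintro ⟨j, hj⟩ h
      exact Van_end1 (d_map F n) (fun c => gF_zero _ _) (d_m F n) h j hj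
    · intro h
      by_contra hne
      push Not at hne
      exact h (Van_end2 (d_lift F n) hne)

end chain
end res
end PK

namespace PK

section exist
variable {V : Type} [Fintype V] [DecidableEq V] {k : Type} [Field k]

theorem hg_isHom {a b : ℕ} {p : MvPolynomial V k} (h : hg ((a : ℤ) - b) p) :
    p.IsHomogeneous (a - b) ∧ (a < b → p = 0) := by
  constructor
  · intro m hm
    have := h m hm
    rw [wt1]
    simp only [Set.mem_ofPred_eq] at this
    omega
  · intro hab
    ext m
    rw [coeff_zero]
    by_contra hne
    have := h m hne
    simp only [Set.mem_ofPred_eq] at this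
    omega

theorem compF_sum {b : ℕ} (deg : Fin b → ℕ) (f : Fin b → MvPolynomial V k) :
    ∃ D : ℕ, f = ∑ c ∈ Finset.range D, compF deg (c : ℤ) f := by
  refine ⟨1 + ∑ l, (deg l + (f l).totalDegree), ?_⟩
  funext l
  rw [Finset.sum_apply]
  ext m
  rw [coeff_sum]
  simp only [compF, coeff_comp]
  by_cases hm : coeff m (f l) = 0
  · simp [hm]
  · have h1 : m.degree ≤ (f l).totalDegree := by
      exact le_totalDegree (mem_support_iff.2 hm)
    have h2 : deg l + (f l).totalDegree ≤ ∑ l, (deg l + (f l).totalDegree) :=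
      Finset.single_le_sum (f := fun l => deg l + (f l).totalDegree) (fun _ _ => Nat.zero_le _)
        (Finset.mem_univ l)
    rw [Finset.sum_eq_single (m.degree + deg l)]
    · rw [if_pos]; push_cast; ring
    · intro c _ hc
      rw [if_neg]; omega
    · intro hn
      exfalso; apply hn; rw [Finset.mem_range]; omega

theorem gens_exist {b : ℕ} (deg : Fin b → ℕ)
    (N : Submodule (MvPolynomial V k) (Fin b → MvPolynomial V k))
    (hN : ∀ c f, f ∈ N → compF deg c f ∈ N) :
    ∃ n : ℕ, ∃ (y : Fin n → Fin b → MvPolynomial V k) (deg' : Fin n → ℕ),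
      (∀ j, gF deg (deg' j) (y j)) ∧ Submodule.span _ (Set.range y) = N := by
  let H : Set (Fin b → MvPolynomial V k) := {y | y ∈ N ∧ ∃ c : ℕ, gF deg c y}
  have hH : Submodule.span (MvPolynomial V k) H = N := by
    apply le_antisymm
    · rw [Submodule.span_le]; exact fun y hy => hy.1
    · intro f hf
      obtain ⟨D, hD⟩ := compF_sum deg f
      rw [hD]
      exact Submodule.sum_mem _ fun c _ => Submodule.subset_span ⟨hN _ _ hf, c, compF_gF _ _ _⟩
  have hfg : (Submodule.span (MvPolynomial V k) H).FG := IsNoetherian.noetherian _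
  rw [Submodule.fg_span_iff_fg_span_finset_subset] at hfg
  obtain ⟨s, hs, hspan⟩ := hfg
  have h1 : ∀ j : Fin s.card, ∃ c : ℕ, gF deg c ((s.equivFin.symm j : s) : Fin b → MvPolynomial V k) :=
    fun j => (hs (s.equivFin.symm j).2).2
  choose deg' hdeg using h1
  refine ⟨s.card, fun j => (s.equivFin.symm j : s), deg', hdeg, ?_⟩
  rw [← hH, hspan]
  congr 1
  ext y
  constructor
  · rintro ⟨j, rfl⟩; exact (s.equivFin.symm j).2
  · intro hy; exact ⟨s.equivFin ⟨y, hy⟩, by simp⟩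

theorem step_exist {b : ℕ} (deg : Fin b → ℕ)
    (N : Submodule (MvPolynomial V k) (Fin b → MvPolynomial V k))
    (hN : ∀ c f, f ∈ N → compF deg c f ∈ N) :
    ∃ (b' : ℕ) (deg' : Fin b' → ℕ) (d : (Fin b' → MvPolynomial V k) →ₗ[MvPolynomial V k]
      (Fin b → MvPolynomial V k)), LinearMap.range d = N ∧
      (∀ j l, hg ((deg' j : ℤ) - deg l) (d (Pi.single j 1) l)) ∧
      ∀ f, d f = 0 → ∀ l, constantCoeff (f l) = 0 := by
  classical
  have hex := gens_exist deg N hN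
  let n := Nat.find hex
  obtain ⟨y, deg', hy, hspan⟩ := Nat.find_spec hex
  have hmin := fun m (hm : m < Nat.find hex) => Nat.find_min hex hm
  generalize Nat.find hex = n at *
  have hd : ∀ j l, hg ((deg' j : ℤ) - deg l)
      (Fintype.linearCombination (MvPolynomial V k) y (Pi.single j 1) l) := by
    intro j l
    rw [Fintype.linearCombination_apply_single, one_smul]
    exact hy j l
  refine ⟨n, deg', Fintype.linearCombination (MvPolynomial V k) y, ?_, hd, ?_⟩
  · rw [Fintype.range_linearCombination, hspan]
  · intro f hf j
    by_contra hne
    have h1 : Fintype.linearCombination (MvPolynomial V k) y (compF deg' (deg' j) f) = 0 := by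
      rw [compF_lin (deg := deg) _ hd, hf]
      funext l; simp [compF]
    have h2 : compF deg' (deg' j) f j = C (constantCoeff (f j)) := by
      simp only [compF, sub_self]
      ext m
      rw [coeff_comp, coeff_C]
      by_cases hm : m = 0
      · subst hm; simp [constantCoeff_eq]
      · rw [if_neg (c := (0 : V →₀ ℕ) = m) (fun h => hm h.symm), if_neg]
        intro h
        exact hm ((Finsupp.degree_eq_zero_iff m).1 (by exact_mod_cast h))
    generalize compF deg' (deg' j) f = f' at h1 h2
    cases n with
    | zero => exact j.elim0
    | succ n =>
      apply hmin n (Nat.lt_succ_self n)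
      refine ⟨fun i => y (j.succAbove i), fun i => deg' (j.succAbove i), fun i => hy _, ?_⟩
      rw [← hspan]
      apply le_antisymm
      · rw [Submodule.span_le]
        rintro _ ⟨i, rfl⟩
        exact Submodule.subset_span ⟨_, rfl⟩
      · rw [Submodule.span_le]
        rintro _ ⟨i, rfl⟩
        have hs : ∀ i, y (j.succAbove i) ∈ Submodule.span (MvPolynomial V k)
            (Set.range fun i => y (j.succAbove i)) := fun i => Submodule.subset_span ⟨i, rfl⟩
        by_cases hij : i = j
        · subst hij
          rw [Fintype.linearCombination_apply, Fin.sum_univ_succAbove _ i, h2] at h1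
          have h3 : y i = -(C (constantCoeff (f i))⁻¹ : MvPolynomial V k) •
              ∑ l, f' (i.succAbove l) • y (i.succAbove l) := by
            have h4 : ∑ l, f' (i.succAbove l) • y (i.succAbove l) =
                - ((C (constantCoeff (f i)) : MvPolynomial V k) • y i) := by
              rw [eq_neg_iff_add_eq_zero, add_comm]; exact h1
            rw [h4, smul_neg, neg_smul, neg_neg, smul_smul, ← C_mul, inv_mul_cancel₀ hne, C_1,
              one_smul]
          rw [SetLike.mem_coe, h3]
          exact Submodule.smul_mem _ _ (Submodule.sum_mem _ fun l _ => Submodule.smul_mem _ _ (hs l))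
        · obtain ⟨l, rfl⟩ := Fin.exists_succAbove_eq hij
          exact hs l

/-- A stage of the construction of a minimal resolution. -/
structure St (V k : Type) [Fintype V] [DecidableEq V] [Field k] where
  b : ℕ
  deg : Fin b → ℕ
  N : Submodule (MvPolynomial V k) (Fin b → MvPolynomial V k)
  hN : ∀ c f, f ∈ N → compF deg c f ∈ N
  hm : ∀ f, f ∈ N → ∀ l, constantCoeff (f l) = 0

theorem St.next_exists (S : St V k) : ∃ (S' : St V k)
    (d : (Fin S'.b → MvPolynomial V k) →ₗ[MvPolynomial V k] (Fin S.b → MvPolynomial V k)),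
    LinearMap.range d = S.N ∧ LinearMap.ker d = S'.N ∧
      ∀ j l, hg ((S'.deg j : ℤ) - S.deg l) (d (Pi.single j 1) l) := by
  obtain ⟨b', deg', d, h1, h2, h3⟩ := step_exist S.deg S.N S.hN
  refine ⟨⟨b', deg', LinearMap.ker d, fun c f hf => ?_, fun f hf => h3 f hf⟩, d, h1, rfl, h2⟩
  rw [LinearMap.mem_ker] at hf ⊢
  rw [compF_lin (deg := S.deg) _ h2, hf]
  funext l; simp [compF]

/-- The next stage. -/
noncomputable def St.next (S : St V k) : St V k := S.next_exists.choose

/-- The differential to the previous stage. -/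
noncomputable def St.nd (S : St V k) : (Fin S.next.b → MvPolynomial V k) →ₗ[MvPolynomial V k]
    (Fin S.b → MvPolynomial V k) := S.next_exists.choose_spec.choose

theorem St.nd_spec (S : St V k) : LinearMap.range S.nd = S.N ∧ LinearMap.ker S.nd = S.next.N ∧
      ∀ j l, hg ((S.next.deg j : ℤ) - S.deg l) (S.nd (Pi.single j 1) l) :=
  S.next_exists.choose_spec.choose_spec

/-- The stages. -/
noncomputable def St.iter (S : St V k) : ℕ → St V k
  | 0 => S
  | n + 1 => (S.iter n).next

/-- The initial stage. -/
noncomputable def St.start (I : Ideal (MvPolynomial V k)) (hI : HomI I)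
    (hI0 : ∀ p ∈ I, constantCoeff p = 0) : St V k where
  b := 1
  deg := fun _ => 0
  N := Submodule.comap (LinearMap.proj (0 : Fin 1) : (Fin 1 → MvPolynomial V k) →ₗ[MvPolynomial V k] _) I
  hN := fun c f hf => by
    rw [Submodule.mem_comap] at hf ⊢
    exact hI _ _ hf
  hm := fun f hf l => by
    rw [Submodule.mem_comap] at hf
    rw [Fin.fin_one_eq_zero l]
    exact hI0 _ hf

theorem res_exists (I : Ideal (MvPolynomial V k)) (hI : HomI I)
    (hI0 : ∀ p ∈ I, constantCoeff p = 0) : Nonempty (MinFreeRes k V I) := by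
  let S := St.start I hI hI0
  refine ⟨{
    b := fun i => (S.iter i).b
    deg := fun i => (S.iter i).deg
    d := fun i => (S.iter i).nd
    aug := I.mkQ.comp (LinearMap.proj (0 : Fin 1))
    aug_surjective := ?_
    exact_zero := ?_
    exact_succ := ?_
    aug_homog := ?_
    d_homog := fun i j l => hg_isHom ((S.iter i).nd_spec.2.2 j l)
    minimal := fun i j l => (S.iter i).hm _ (by
      rw [← (S.iter i).nd_spec.1]; exact ⟨_, rfl⟩) l }⟩
  · intro x
    obtain ⟨p, rfl⟩ := I.mkQ_surjective x
    exact ⟨fun _ => p, rfl⟩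
  · intro y
    have h : y ∈ LinearMap.range (S.iter 0).nd ↔ y ∈ S.N := by rw [(S.iter 0).nd_spec.1]; rfl
    refine Iff.trans ?_ h.symm
    change I.mkQ (y (0 : Fin 1)) = 0 ↔ y (0 : Fin 1) ∈ I
    rw [Submodule.mkQ_apply, Submodule.Quotient.mk_eq_zero]
  · intro i y
    have h1 : LinearMap.range (S.iter (i + 1)).nd = LinearMap.ker (S.iter i).nd := by
      rw [(S.iter (i + 1)).nd_spec.1, (S.iter i).nd_spec.2.1]; rfl
    have h : y ∈ LinearMap.range (S.iter (i + 1)).nd ↔ y ∈ LinearMap.ker (S.iter i).nd := by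
      exact SetLike.ext_iff.1 h1 y
    exact h.symm
  · intro j
    refine ⟨1, isHomogeneous_one _ _, ?_⟩
    have hj : j = (0 : Fin 1) := Fin.fin_one_eq_zero j
    subst hj
    change I.mkQ ((Pi.single (0 : Fin 1) (1 : MvPolynomial V k) : Fin 1 → MvPolynomial V k) 0) = _
    rw [Pi.single_eq_same]; rfl

end exist
end PK

namespace PK

section tree
variable {V : Type} [Fintype V] [DecidableEq V] (T : RTree V)

theorem level_spec (v : V) : T.parent^[T.level v] v = T.root := Nat.find_spec (T.reach v)

theorem level_le {v : V} {n : ℕ} (h : T.parent^[n] v = T.root) : T.level v ≤ n :=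
  Nat.find_min' _ h

theorem level_root : T.level T.root = 0 := Nat.le_zero.1 (level_le T rfl)

theorem level_eq_zero {v : V} (h : T.level v = 0) : v = T.root := by
  have := level_spec T v
  rwa [h] at this

theorem level_parent (v : V) : T.level (T.parent v) = T.level v - 1 := by
  rcases Nat.eq_zero_or_pos (T.level v) with h | h
  · rw [level_eq_zero T h, T.parent_root, level_root]
  · apply le_antisymm
    · apply level_le
      rw [← Function.iterate_succ_apply, Nat.succ_eq_add_one, Nat.sub_add_cancel h]
      exact level_spec T v
    · have : T.level v ≤ T.level (T.parent v) + 1 := by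
        apply level_le
        rw [Function.iterate_succ_apply]
        exact level_spec T _
      omega

theorem level_iter (v : V) (j : ℕ) : T.level (T.parent^[j] v) = T.level v - j := by
  induction j with
  | zero => rfl
  | succ j ih => rw [Function.iterate_succ_apply', level_parent, ih]; omega

theorem level_le_height (v : V) : T.level v ≤ T.height :=
  Finset.le_sup (f := fun v => T.level v) (Finset.mem_univ v)

/-- The children of a vertex. -/
def ch (v : V) : Finset V := by
  classical exact Finset.univ.filter fun c => T.parent c = v ∧ c ≠ T.root

theorem mem_ch {v c : V} : c ∈ ch T v ↔ T.parent c = v ∧ c ≠ T.root := by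
  simp [ch]

theorem level_ch {v c : V} (h : c ∈ ch T v) : T.level c = T.level v + 1 := by
  rw [mem_ch] at h
  have h1 := level_parent T c
  have h2 : T.level c ≠ 0 := fun h0 => h.2 (level_eq_zero T h0)
  rw [h.1] at h1
  omega

theorem mem_ch' {v c : V} (h : T.parent c = v) (hl : T.level c ≠ 0) : c ∈ ch T v := by
  rw [mem_ch]
  refine ⟨h, ?_⟩
  rintro rfl
  exact hl (level_root T)

theorem outdeg_eq (v : V) : T.outdeg v = (ch T v).card := by
  unfold RTree.outdeg
  rw [← Nat.card_eq_finsetCard]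
  exact Nat.card_congr (Equiv.subtypeEquivRight fun x => (mem_ch T).symm)

theorem exists_ch (hp : T.Perfect) {v : V} (h : T.level v < T.height) : ∃ c, c ∈ ch T v := by
  by_contra hne
  push Not at hne
  have : T.IsLeaf v := by
    intro y hy
    by_contra hr
    exact hne y ((mem_ch T).2 ⟨hy, hr⟩)
  have := hp v this
  omega

/-- Descendants up to depth `n`. -/
def W : ℕ → V → Finset V
  | 0, v => {v}
  | n + 1, v => {v} ∪ (ch T v).biUnion (W n)

/-- The order function. -/
def ord : ℕ → V → (V →₀ ℕ) → ℕ
  | 0, v, m => m v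
  | n + 1, v, m => min (m v) (∑ c ∈ ch T v, ord n c m)

/-- Number of inner vertices. -/
def cnt : ℕ → V → ℕ
  | 0, _ => 0
  | n + 1, v => 1 + ∑ c ∈ ch T v, cnt n c

theorem mem_W {n : ℕ} {v w : V} (h : w ∈ W T n v) :
    ∃ j ≤ n, T.parent^[j] w = v ∧ T.level w = T.level v + j := by
  induction n generalizing v with
  | zero =>
    simp only [W, Finset.mem_singleton] at h
    exact ⟨0, le_rfl, h, by rw [h]; rfl⟩
  | succ n ih =>
    simp only [W, Finset.mem_union, Finset.mem_singleton, Finset.mem_biUnion] at h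
    rcases h with rfl | ⟨c, hc, hw⟩
    · exact ⟨0, Nat.zero_le _, rfl, rfl⟩
    · obtain ⟨j, hj, h1, h2⟩ := ih hw
      refine ⟨j + 1, by omega, ?_, ?_⟩
      · rw [Function.iterate_succ_apply', h1]; exact ((mem_ch T).1 hc).1
      · rw [h2, level_ch T hc]; omega

theorem mem_W_of {n j : ℕ} {v w : V} (hj : j ≤ n) (h : T.parent^[j] w = v)
    (hl : T.level w = T.level v + j) : w ∈ W T n v := by
  induction n generalizing v j with
  | zero =>
    obtain rfl : j = 0 := by omega
    simpa [W] using h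
  | succ n ih =>
    simp only [W, Finset.mem_union, Finset.mem_singleton, Finset.mem_biUnion]
    cases j with
    | zero => exact Or.inl h
    | succ j =>
      right
      have h1 := level_iter T w j
      refine ⟨T.parent^[j] w, ?_, ih (by omega) rfl (by omega)⟩
      rw [Function.iterate_succ_apply'] at h
      exact mem_ch' T h (by omega)

theorem W_root : W T T.height T.root = Finset.univ := by
  refine Finset.eq_univ_of_forall fun w => ?_
  exact mem_W_of T (level_le_height T w) (level_spec T w) (by rw [level_root]; omega)

theorem self_mem_W (n : ℕ) (v : V) : v ∈ W T n v := mem_W_of T (Nat.zero_le _) rfl rfl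

theorem W_disj {n : ℕ} {v c c' : V} (hc : c ∈ ch T v) (hc' : c' ∈ ch T v) (hne : c ≠ c') :
    Disjoint (W T n c) (W T n c') := by
  rw [Finset.disjoint_left]
  intro w h h'
  obtain ⟨j, _, h1, h2⟩ := mem_W T h
  obtain ⟨j', _, h1', h2'⟩ := mem_W T h'
  rw [level_ch T hc] at h2
  rw [level_ch T hc'] at h2'
  obtain rfl : j = j' := by omega
  exact hne (h1.symm.trans h1')

theorem v_notMem_W {n : ℕ} {v c : V} (hc : c ∈ ch T v) : v ∉ W T n c := by
  intro h
  obtain ⟨j, _, _, h2⟩ := mem_W T h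
  rw [level_ch T hc] at h2
  omega

theorem W_child_sub {n : ℕ} {v c : V} (hc : c ∈ ch T v) : W T n c ⊆ W T (n + 1) v := by
  intro w hw
  simp only [W, Finset.mem_union, Finset.mem_biUnion]
  exact Or.inr ⟨c, hc, hw⟩

theorem sum_W {n : ℕ} (v : V) (φ : V → ℕ) :
    ∑ w ∈ W T (n + 1) v, φ w = φ v + ∑ c ∈ ch T v, ∑ w ∈ W T n c, φ w := by
  have h1 : Disjoint {v} ((ch T v).biUnion (W T n)) := by
    rw [Finset.disjoint_singleton_left, Finset.mem_biUnion]
    rintro ⟨c, hc, h⟩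
    exact v_notMem_W T hc h
  rw [W, Finset.sum_union h1, Finset.sum_singleton, Finset.sum_biUnion]
  intro c hc c' hc' hne
  exact W_disj T hc hc' hne

theorem cnt_eq (n : ℕ) (v : V) :
    cnt T n v = ∑ w ∈ W T n v, if T.level w < T.level v + n then 1 else 0 := by
  induction n generalizing v with
  | zero => rw [W, Finset.sum_singleton, if_neg (by omega)]; rfl
  | succ n ih =>
    rw [sum_W, cnt, if_pos (by omega)]
    congr 1
    refine Finset.sum_congr rfl fun c hc => ?_
    rw [ih, level_ch T hc]
    refine Finset.sum_congr rfl fun w _ => ?_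
    rw [show T.level v + 1 + n = T.level v + (n + 1) by ring]

theorem cnt_outdeg (n : ℕ) (v : V) :
    cnt T (n + 1) v =
      1 + ∑ w ∈ W T (n + 1) v, if T.level w + 2 ≤ T.level v + (n + 1) then T.outdeg w else 0 := by
  induction n generalizing v with
  | zero =>
    rw [sum_W, cnt, if_neg (by omega)]
    congr 1
    rw [zero_add]
    refine Finset.sum_congr rfl fun c hc => ?_
    simp [cnt, W, level_ch T hc]
  | succ n ih =>
    rw [sum_W, cnt, if_pos (by omega), outdeg_eq, Finset.card_eq_sum_ones,
      ← Finset.sum_add_distrib]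
    congr 1
    refine Finset.sum_congr rfl fun c hc => ?_
    rw [ih, level_ch T hc]
    congr 1
    refine Finset.sum_congr rfl fun w _ => ?_
    rw [show T.level v + 1 + (n + 1) = T.level v + (n + 1 + 1) by ring]

theorem ord_mono (n : ℕ) (v : V) : Monotone (ord T n v) := by
  induction n generalizing v with
  | zero => intro m m' h; exact h v
  | succ n ih =>
    intro m m' h
    exact min_le_min (h v) (Finset.sum_le_sum fun c _ => ih c h)

theorem ord_super (n : ℕ) (v : V) (m m' : V →₀ ℕ) :
    ord T n v m + ord T n v m' ≤ ord T n v (m + m') := by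
  induction n generalizing v with
  | zero => simp [ord]
  | succ n ih =>
    simp only [ord]
    have : ∑ c ∈ ch T v, ord T n c m + ∑ c ∈ ch T v, ord T n c m' ≤
        ∑ c ∈ ch T v, ord T n c (m + m') := by
      rw [← Finset.sum_add_distrib]
      exact Finset.sum_le_sum fun c _ => ih c
    rw [Finsupp.add_apply]
    omega

theorem ord_congr (n : ℕ) (v : V) {m m' : V →₀ ℕ} (h : ∀ w ∈ W T n v, m w = m' w) :
    ord T n v m = ord T n v m' := by
  induction n generalizing v with
  | zero => exact h v (by simp [W])
  | succ n ih =>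
    simp only [ord]
    rw [h v (self_mem_W T _ _)]
    congr 1
    exact Finset.sum_congr rfl fun c hc => ih c fun w hw => h w (W_child_sub T hc hw)

theorem Fil_of_empty {W : Finset V} {r : ℕ} {X : Set (V →₀ ℕ)} (h : ∀ m, m ∉ X) : Fil W r X := by
  rw [Set.eq_empty_of_forall_notMem h]; exact Fil.empty _ _

theorem Fil_eq (v : V) (a : ℕ) : Fil {v} a {m : V →₀ ℕ | m v = a} := by
  have := Fil.cell {v} a ∅ (fun _ => a) (by simp)
  convert this using 1
  ext m; simp

theorem Fil_ge (v : V) (a : ℕ) : Fil {v} a {m : V →₀ ℕ | a ≤ m v} := by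
  have := Fil.cell {v} a {v} (fun _ => a) (by simp)
  convert this using 1
  ext m; simp

theorem Fil_sum (n : ℕ) (v : V)
    (hE : ∀ c ∈ ch T v, ∀ a, Fil (W T n c) ((n + 1) * a + cnt T n c) {m | ord T n c m = a})
    (hG : ∀ c ∈ ch T v, ∀ a, Fil (W T n c) ((n + 1) * a + cnt T n c + 1) {m | a + 1 ≤ ord T n c m})
    (C : Finset V) (hC : C ⊆ ch T v) : ∀ a,
    Fil (C.biUnion (W T n)) ((n + 1) * a + ∑ c ∈ C, cnt T n c) {m | ∑ c ∈ C, ord T n c m = a} ∧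
    Fil (C.biUnion (W T n)) ((n + 1) * a + ∑ c ∈ C, cnt T n c + 1)
      {m | a + 1 ≤ ∑ c ∈ C, ord T n c m} := by
  induction C using Finset.induction_on with
  | empty =>
    intro a
    constructor
    · rcases Nat.eq_zero_or_pos a with rfl | ha
      · convert (Fil.univ (Finset.biUnion ∅ (W T n))).mono (Nat.zero_le _)
        simp
      · convert Fil.empty _ _
        ext m; simp; omega
    · convert Fil.empty _ _
      ext m; simp
  | insert c C hcC ih =>
    intro a
    have hcv : c ∈ ch T v := hC (Finset.mem_insert_self _ _)
    have ih := ih fun x hx => hC (Finset.mem_insert_of_mem hx)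
    have hdis : Disjoint (W T n c) (C.biUnion (W T n)) := by
      rw [Finset.disjoint_biUnion_right]
      intro c' hc'
      refine W_disj T hcv (hC (Finset.mem_insert_of_mem hc')) ?_
      rintro rfl; exact hcC hc'
    simp only [Finset.biUnion_insert, Finset.sum_insert hcC]
    have hmul : ∀ j, j ≤ a → (n + 1) * j + (n + 1) * (a - j) = (n + 1) * a := by
      intro j hj; rw [← mul_add, Nat.add_sub_cancel' hj]
    constructor
    · refine Fil.slice _ (ord T n c) (ord_mono T n c) (a + 1) (fun j hj => ?_) ?_
      · have h1 := Fil.prod hdis (hE c hcv j) (ih (a - j)).1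
        have h2 := h1.mono (r' := (n + 1) * a + (cnt T n c + ∑ c ∈ C, cnt T n c))
          (by have := hmul j (by omega); omega)
        convert h2 using 1
        ext m; simp only [Set.mem_inter_iff, Set.mem_ofPred_eq]; omega
      · refine Fil_of_empty fun m hm => ?_
        simp only [Set.mem_inter_iff, Set.mem_ofPred_eq] at hm; omega
    · refine Fil.slice _ (ord T n c) (ord_mono T n c) (a + 1) (fun j hj => ?_) ?_
      · have h1 := Fil.prod hdis (hE c hcv j) (ih (a - j)).2
        have h2 := h1.mono (r' := (n + 1) * a + (cnt T n c + ∑ c ∈ C, cnt T n c) + 1)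
          (by have := hmul j (by omega); omega)
        convert h2 using 1
        ext m; simp only [Set.mem_inter_iff, Set.mem_ofPred_eq]; omega
      · have h1 := (hG c hcv a).enlarge (Finset.subset_union_left (s₂ := C.biUnion (W T n)))
        have h2 := h1.mono (r' := (n + 1) * a + (cnt T n c + ∑ c ∈ C, cnt T n c) + 1)
          (by omega)
        convert h2 using 1
        ext m; simp only [Set.mem_inter_iff, Set.mem_ofPred_eq]; omega

theorem Fil_ord (n : ℕ) : ∀ (v : V) (a : ℕ),
    Fil (W T n v) ((n + 1) * a + cnt T n v) {m | ord T n v m = a} ∧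
    Fil (W T n v) ((n + 1) * a + cnt T n v + 1) {m | a + 1 ≤ ord T n v m} := by
  induction n with
  | zero =>
    intro v a
    simp only [W, ord, cnt]
    exact ⟨(Fil_eq v a).mono (by omega), (Fil_ge v (a + 1)).mono (by omega)⟩
  | succ n ih =>
    intro v a
    have hS := Fil_sum T n v (fun c _ a => (ih c a).1) (fun c _ a => (ih c a).2) (ch T v) le_rfl a
    have hdis : Disjoint {v} ((ch T v).biUnion (W T n)) := by
      rw [Finset.disjoint_singleton_left, Finset.mem_biUnion]
      rintro ⟨c, hc, h⟩
      exact v_notMem_W T hc h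
    have hmul : a + (n + 1) * a = (n + 1 + 1) * a := by ring
    simp only [W, ord, cnt]
    constructor
    · refine Fil.ext _ _ _ ({m | a ≤ m v} ∩ {m | ∑ c ∈ ch T v, ord T n c m = a})
        ({m | m v = a} ∩ {m | a + 1 ≤ ∑ c ∈ ch T v, ord T n c m}) ?_ ?_ ?_ ?_
      · ext m
        simp only [Set.mem_inter_iff, Set.mem_ofPred_eq, Set.mem_union]; omega
      · rintro z ⟨_, hz⟩ y ⟨_, hy⟩ hzy
        have : ∑ c ∈ ch T v, ord T n c z ≤ ∑ c ∈ ch T v, ord T n c y :=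
          Finset.sum_le_sum fun c _ => ord_mono T n c hzy
        simp only [Set.mem_ofPred_eq] at hz hy
        omega
      · exact (Fil.prod hdis (Fil_ge v a) hS.1).mono (by omega)
      · exact (Fil.prod hdis (Fil_eq v a) hS.2).mono (by omega)
    · convert (Fil.prod hdis (Fil_ge v (a + 1)) hS.2).mono (r' := (n + 1 + 1) * a +
        (1 + ∑ c ∈ ch T v, cnt T n c) + 1) (by omega) using 1
      ext m
      simp only [Set.mem_inter_iff, Set.mem_ofPred_eq]; omega

theorem Fil_final (s : ℕ) (hs : 1 ≤ s) :
    Fil Finset.univ ((T.height + 1) * (s - 1) + cnt T T.height T.root)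
      {m | ord T T.height T.root m < s} := by
  refine Fil.slice _ (ord T T.height T.root) (ord_mono T _ _) s (fun j hj => ?_) ?_
  · have h1 := (Fil_ord T T.height T.root j).1
    rw [W_root] at h1
    have h3 : (T.height + 1) * j ≤ (T.height + 1) * (s - 1) := Nat.mul_le_mul_left _ (by omega)
    have h2 := h1.mono (r' := (T.height + 1) * (s - 1) + cnt T T.height T.root) (by omega)
    convert h2 using 1
    ext m; simp only [Set.mem_inter_iff, Set.mem_ofPred_eq]; omega
  · refine Fil_of_empty fun m hm => ?_
    simp only [Set.mem_inter_iff, Set.mem_ofPred_eq] at hm; omega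

end tree
end PK

namespace PK

section ideal
variable {V : Type} [Fintype V] [DecidableEq V] (T : RTree V) {k : Type} [Field k]

/-- The exponent of a path. -/
noncomputable def pth (n : ℕ) (w : V) : V →₀ ℕ :=
  ∑ j ∈ Finset.range (n + 1), Finsupp.single (T.parent^[j] w) 1

theorem pth_zero (w : V) : pth T 0 w = Finsupp.single w 1 := by simp [pth]

theorem pth_succ (n : ℕ) (w : V) :
    pth T (n + 1) w = pth T n w + Finsupp.single (T.parent^[n + 1] w) 1 := by
  rw [pth, Finset.sum_range_succ]; rfl

theorem pth_eq_zero {n : ℕ} {w u : V} (h : ∀ j ≤ n, T.parent^[j] w ≠ u) : pth T n w u = 0 := by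
  rw [pth, Finsupp.finsetSum_apply]
  refine Finset.sum_eq_zero fun j hj => ?_
  rw [Finsupp.single_apply, if_neg (h j (by rw [Finset.mem_range] at hj; omega))]

theorem pth_pos {n : ℕ} {w : V} {j : ℕ} (hj : j ≤ n) : 1 ≤ pth T n w (T.parent^[j] w) := by
  rw [pth, Finsupp.finsetSum_apply]
  have := Finset.single_le_sum (f := fun i => Finsupp.single (T.parent^[i] w) 1 (T.parent^[j] w))
    (s := Finset.range (n + 1)) (fun _ _ => Nat.zero_le _) (Finset.mem_range.2 (by omega : j < n + 1))
  simpa using this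

theorem pth_le_one {n : ℕ} {w : V} (h : n ≤ T.level w) (u : V) : pth T n w u ≤ 1 := by
  induction n with
  | zero => rw [pth_zero, Finsupp.single_apply]; split_ifs <;> omega
  | succ n ih =>
    rw [pth_succ, Finsupp.add_apply, Finsupp.single_apply]
    split_ifs with h1
    · rw [pth_eq_zero]
      intro j hj h2
      have h3 := level_iter T w j
      have h4 := level_iter T w (n + 1)
      rw [h1] at h4
      rw [h2] at h3
      omega
    · have := ih (by omega); omega

theorem pth_degree (n : ℕ) (w : V) : (pth T n w).degree = n + 1 := by
  induction n with
  | zero => simp [pth_zero]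
  | succ n ih => rw [pth_succ, map_add, ih]; simp

theorem pathMonomial_eq (n : ℕ) (w : V) :
    T.pathMonomial k (n + 1) w = monomial (pth T n w) 1 := by
  unfold RTree.pathMonomial pth
  rw [monomial_sum_one]
  rfl

theorem ord_pos (n : ℕ) {v w : V} {m : V →₀ ℕ} (hw : T.parent^[n] w = v)
    (hl : n ≤ T.level w) (hm : ∀ j ≤ n, 1 ≤ m (T.parent^[j] w)) : 1 ≤ ord T n v m := by
  induction n generalizing v with
  | zero => subst hw; exact hm 0 le_rfl
  | succ n ih =>
    simp only [ord]
    refine le_min (by rw [← hw]; exact hm _ le_rfl) ?_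
    have h1 := ih rfl (by omega) fun j hj => hm j (by omega)
    refine h1.trans (Finset.single_le_sum (f := fun c => ord T n c m) (fun _ _ => Nat.zero_le _) ?_)
    rw [Function.iterate_succ_apply'] at hw
    exact mem_ch' T hw (by rw [level_iter]; omega)

theorem ord_split (n : ℕ) {v : V} {m : V →₀ ℕ} (h : 1 ≤ ord T n v m) :
    ∃ w, T.parent^[n] w = v ∧ T.level w = T.level v + n ∧ pth T n w ≤ m ∧
      ord T n v m ≤ ord T n v (m - pth T n w) + 1 := by
  induction n generalizing v with
  | zero =>
    refine ⟨v, rfl, rfl, ?_, ?_⟩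
    · rw [pth_zero, Finsupp.single_le_iff]; exact h
    · simp only [ord, pth_zero, Finsupp.tsub_apply, Finsupp.single_eq_same]; omega
  | succ n ih =>
    simp only [ord] at h
    have h1 : 1 ≤ m v := h.trans (min_le_left _ _)
    have h2 : 1 ≤ ∑ c ∈ ch T v, ord T n c m := h.trans (min_le_right _ _)
    obtain ⟨c, hc, hc0⟩ := Finset.exists_ne_zero_of_sum_ne_zero (by omega : ∑ c ∈ ch T v, ord T n c m ≠ 0)
    obtain ⟨w, hw1, hw2, hw3, hw4⟩ := ih (v := c) (by omega)
    have hlc := level_ch T hc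
    have hwv : T.parent^[n + 1] w = v := by
      rw [Function.iterate_succ_apply', hw1]; exact ((mem_ch T).1 hc).1
    have hq : pth T (n + 1) w = pth T n w + Finsupp.single v 1 := by rw [pth_succ, hwv]
    have hqW : ∀ u, u ∉ W T n c → pth T n w u = 0 := by
      intro u hu
      refine pth_eq_zero T fun j hj hju => hu ?_
      have h3 := level_iter T w j
      subst hju
      refine mem_W_of T (j := n - j) (by omega) ?_ (by omega)
      rw [← Function.iterate_add_apply, Nat.sub_add_cancel hj]; exact hw1
    have hqv : pth T n w v = 0 := hqW v (v_notMem_W T hc)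
    refine ⟨w, hwv, by omega, ?_, ?_⟩
    · rw [hq]
      intro u
      rw [Finsupp.add_apply, Finsupp.single_apply]
      split_ifs with hu
      · subst hu; rw [hqv]; omega
      · exact hw3 u
    · have hsub : ∀ u, u ≠ v → (m - pth T (n + 1) w) u = (m - pth T n w) u := by
        intro u hu
        rw [hq, Finsupp.tsub_apply, Finsupp.tsub_apply, Finsupp.add_apply, Finsupp.single_apply,
          if_neg (Ne.symm hu), add_zero]
      have hc1 : ord T n c (m - pth T (n + 1) w) = ord T n c (m - pth T n w) := by
        refine ord_congr T n c fun u hu => hsub u ?_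
        rintro rfl; exact v_notMem_W T hc hu
      have hc2 : ∀ c' ∈ (ch T v).erase c, ord T n c' (m - pth T (n + 1) w) = ord T n c' m := by
        intro c' hc'
        rw [Finset.mem_erase] at hc'
        refine ord_congr T n c' fun u hu => ?_
        rw [hsub u (by rintro rfl; exact v_notMem_W T hc'.2 hu), Finsupp.tsub_apply, hqW, Nat.sub_zero]
        intro hu'
        exact Finset.disjoint_left.1 (W_disj T hc'.2 hc hc'.1) hu hu'
      have hv : (m - pth T (n + 1) w) v = m v - 1 := by
        rw [hq, Finsupp.tsub_apply, Finsupp.add_apply, hqv]; simp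
      simp only [ord]
      rw [hv, ← Finset.add_sum_erase _ _ hc, ← Finset.add_sum_erase _ _ hc, hc1,
        Finset.sum_congr rfl hc2]
      omega

theorem SIn_mul {A B C : Set (V →₀ ℕ)} (h : ∀ a ∈ A, ∀ b ∈ B, a + b ∈ C)
    {p q : MvPolynomial V k} (hp : SIn A p) (hq : SIn B q) : SIn C (p * q) := by
  intro m hm
  rw [coeff_mul] at hm
  obtain ⟨x, hx, hne⟩ := Finset.exists_ne_zero_of_sum_ne_zero hm
  rw [Finset.HasAntidiagonal.mem_antidiagonal] at hx
  rw [← hx]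
  exact h _ (hp _ (left_ne_zero_of_mul hne)) _ (hq _ (right_ne_zero_of_mul hne))

/-- The exponents of order at least `s`. -/
def US (s : ℕ) : Set (V →₀ ℕ) := {m | s ≤ ord T T.height T.root m}

theorem US_upper (s : ℕ) : IsUpperSet (US T s) := by
  intro m m' h hm
  exact le_trans (hm : s ≤ _) (ord_mono T _ _ h)

theorem US_add {a b : ℕ} {m m' : V →₀ ℕ} (h : m ∈ US T a) (h' : m' ∈ US T b) :
    m + m' ∈ US T (a + b) :=
  le_trans (Nat.add_le_add h h') (ord_super T _ _ m m')

/-- The monomial ideal of the exponents of order at least `s`. -/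
noncomputable def JS (k : Type) [Field k] (s : ℕ) : Ideal (MvPolynomial V k) where
  carrier := {p | SIn (US T s) p}
  add_mem' := fun ha hb => SIn.add ha hb
  zero_mem' := SIn.zero
  smul_mem' := fun c p hp => by
    refine SIn_mul (A := Set.univ) (fun a _ b hb => ?_) (fun _ _ => trivial) hp
    exact US_upper T s (by rw [add_comm]; exact le_self_add) hb

theorem mem_JS {s : ℕ} {p : MvPolynomial V k} : p ∈ JS T k s ↔ SIn (US T s) p := Iff.rfl

theorem pth_mem_US {w : V} (h : T.level w = T.height) : pth T T.height w ∈ US T 1 := by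
  refine ord_pos T _ ?_ h.ge fun j hj => pth_pos T hj
  rw [← h]; exact level_spec T w

theorem pathIdeal_le : T.pathIdeal k (T.height + 1) ≤ JS T k 1 := by
  unfold RTree.pathIdeal
  rw [Ideal.span_le]
  rintro _ ⟨v, hv, rfl⟩
  have hv' : T.level v = T.height := by have := level_le_height T v; omega
  rw [pathMonomial_eq]
  intro m hm
  rw [coeff_monomial] at hm
  split_ifs at hm with h
  · subst h; exact pth_mem_US T hv'
  · exact absurd rfl hm

theorem pow_le_JS (s : ℕ) : (T.pathIdeal k (T.height + 1)) ^ s ≤ JS T k s := by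
  induction s with
  | zero => intro p _ m _; exact Nat.zero_le _
  | succ s ih =>
    rw [pow_succ, Ideal.mul_le]
    intro p hp q hq
    exact SIn_mul (fun a ha b hb => US_add T ha hb) (ih hp) (pathIdeal_le T hq)

theorem monomial_mem_pow (s : ℕ) {m : V →₀ ℕ} (h : m ∈ US T s) (a : k) :
    monomial m a ∈ (T.pathIdeal k (T.height + 1)) ^ s := by
  induction s generalizing m with
  | zero => simp
  | succ s ih =>
    have h' : s + 1 ≤ ord T T.height T.root m := h
    obtain ⟨w, hw1, hw2, hw3, hw4⟩ := ord_split T T.height (v := T.root) (m := m) (by omega)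
    have h1 : monomial m a = monomial (m - pth T T.height w) a * T.pathMonomial k (T.height + 1) w := by
      rw [pathMonomial_eq, monomial_mul, mul_one, tsub_add_cancel_of_le hw3]
    rw [h1, pow_succ]
    refine Ideal.mul_mem_mul (ih ?_) (Ideal.subset_span ⟨w, ?_, rfl⟩)
    · change s ≤ ord T T.height T.root _
      omega
    · rw [level_root] at hw2; omega

theorem mem_pow_iff {s : ℕ} {p : MvPolynomial V k} :
    p ∈ (T.pathIdeal k (T.height + 1)) ^ s ↔ SIn (US T s) p := by
  constructor
  · intro h; exact pow_le_JS T s h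
  · intro h
    rw [p.as_sum]
    refine Ideal.sum_mem _ fun m hm => monomial_mem_pow T s (h m (mem_support_iff.1 hm)) _

theorem HomI_pow (s : ℕ) : HomI ((T.pathIdeal k (T.height + 1)) ^ s) := by
  intro c p hp
  rw [mem_pow_iff] at hp ⊢
  exact comp_SIn c hp

theorem ord_zero (n : ℕ) (v : V) : ord T n v 0 = 0 := by
  cases n <;> simp [ord]

theorem const_pow {s : ℕ} (hs : 1 ≤ s) (p : MvPolynomial V k)
    (hp : p ∈ (T.pathIdeal k (T.height + 1)) ^ s) : constantCoeff p = 0 := by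
  rw [mem_pow_iff] at hp
  by_contra hne
  have : s ≤ ord T T.height T.root 0 := hp 0 hne
  rw [ord_zero] at this
  omega

theorem Van_upper {s : ℕ} (hs : 1 ≤ s) (a : ℕ) (c : ℤ)
    (hc : (((T.height + 1) * (s - 1) + cnt T T.height T.root : ℕ) : ℤ) < c) :
    Van (⊤ : Submodule (MvPolynomial V k)
      (MvPolynomial V k ⧸ (T.pathIdeal k (T.height + 1)) ^ s)) (grI _) a c := by
  intro f _ _ hgr hd
  choose f' hf' hff using hgr
  have hunion : US T s ∪ {m | ord T T.height T.root m < s} = Set.univ := by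
    ext m
    simp only [US, Set.mem_union, Set.mem_ofPred_eq, Set.mem_univ, iff_true]; omega
  have hRL := Fil_RL (k := k) (Fil_final T s hs) (US T s) (US_upper T s)
    (by rw [hunion]; exact isUpperSet_univ)
    (by
      rw [Set.disjoint_left]
      intro m h1 h2
      simp only [US, Set.mem_ofPred_eq] at h1 h2
      omega) c hc
  have hker : ∀ g : Finset V → MvPolynomial V k, ∀ σ,
      kd k (fun τ => Ideal.Quotient.mk ((T.pathIdeal k (T.height + 1)) ^ s) (g τ)) σ =
        Ideal.Quotient.mk ((T.pathIdeal k (T.height + 1)) ^ s) (kd k g σ) :=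
    fun g σ => kd_map (Submodule.mkQ ((T.pathIdeal k (T.height + 1)) ^ s)) g σ
  obtain ⟨g, hg⟩ := hRL f' (fun σ => by rw [hunion]; exact fun _ _ => trivial) hf' (fun σ => by
    rw [← mem_pow_iff, ← Ideal.Quotient.eq_zero_iff_mem, ← hker, ← hd σ]
    congr 1; funext τ; exact hff τ)
  refine ⟨fun τ => Ideal.Quotient.mk _ (g τ), fun _ => trivial, fun σ => ?_⟩
  rw [hker, ← hff σ]
  symm
  rw [Ideal.Quotient.eq, mem_pow_iff]
  exact hg σ

end ideal
end PK

namespace PK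

section functional
variable {V : Type} [Fintype V] [DecidableEq V] {k : Type} [Field k]

/-- Exponent of a squarefree monomial. -/
noncomputable def ind (σ : Finset V) : V →₀ ℕ := ∑ v ∈ σ, Finsupp.single v 1

theorem ind_apply (σ : Finset V) (v : V) : ind σ v = if v ∈ σ then 1 else 0 := by
  rw [ind, Finsupp.finsetSum_apply]
  simp [Finsupp.single_apply]

theorem ind_insert {v : V} {σ : Finset V} (h : v ∉ σ) :
    ind (insert v σ) = Finsupp.single v 1 + ind σ := by
  rw [ind, Finset.sum_insert h]; rfl

theorem ind_degree (σ : Finset V) : (ind σ).degree = σ.card := by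
  rw [ind, map_sum]; simp

open Classical in
/-- Coefficients in a fixed multidegree. -/
noncomputable def CC (b : V →₀ ℕ) (f : Finset V → MvPolynomial V k) (σ : Finset V) : k :=
  if ind σ ≤ b then coeff (b - ind σ) (f σ) else 0

theorem CC_kd (b : V →₀ ℕ) (g : Finset V → MvPolynomial V k) (σ : Finset V) :
    CC b (kd k g) σ = ∑ v, iota v (CC b g) σ := by
  by_cases h : ind σ ≤ b
  · rw [CC, if_pos h, kd, coeff_sum]
    refine Finset.sum_congr rfl fun v _ => ?_
    rw [smul_eq_mul]
    by_cases hv : v ∈ σ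
    · simp [iota, hv]
    · simp only [iota, if_neg hv, CC, ind_insert hv]
      rw [mul_smul_comm, coeff_zsm, coeff_X_mul']
      congr 1
      have hiff : v ∈ (b - ind σ).support ↔ Finsupp.single v 1 + ind σ ≤ b := by
        rw [Finsupp.mem_support_iff, Finsupp.tsub_apply, ind_apply, if_neg hv, Nat.sub_zero]
        constructor
        · intro h1 u
          rw [Finsupp.add_apply, Finsupp.single_apply]
          split_ifs with hu
          · subst hu; rw [ind_apply, if_neg hv]; omega
          · have := h u; omega
        · intro h1
          have := h1 v
          rw [Finsupp.add_apply, Finsupp.single_eq_same] at this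
          omega
      by_cases h2 : v ∈ (b - ind σ).support
      · rw [if_pos h2, if_pos (hiff.1 h2), tsub_tsub, add_comm]
      · rw [if_neg h2, if_neg (fun h3 => h2 (hiff.2 h3))]
  · rw [CC, if_neg h]
    symm
    refine Finset.sum_eq_zero fun v _ => ?_
    by_cases hv : v ∈ σ
    · simp [iota, hv]
    · simp only [iota, if_neg hv, CC, ind_insert hv]
      rw [if_neg, smul_zero]
      intro h1
      exact h (le_trans le_add_self h1)

/-- Contraction by a sum of basis vectors. -/
noncomputable def om (ρ : V → V) (z : V) (F : Finset V → k) : Finset V → k :=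
  fun σ => ∑ v ∈ Finset.univ.filter (fun v => ρ v = z), iota v F σ

theorem om_add (ρ : V → V) (z : V) (F G : Finset V → k) :
    om ρ z (F + G) = om ρ z F + om ρ z G := by
  funext σ; simp [om, iota_add, Finset.sum_add_distrib]

theorem iota_fsum {α : Type} (s : Finset α) (v : V) (F : α → Finset V → k) (σ : Finset V) :
    iota v (fun τ => ∑ a ∈ s, F a τ) σ = ∑ a ∈ s, iota v (F a) σ := by
  by_cases h : v ∈ σ
  · simp [iota, h]
  · simp [iota, h, Finset.mul_sum]

theorem om_om (ρ : V → V) (z z' : V) (F : Finset V → k) (σ : Finset V) :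
    om ρ z (om ρ z' F) σ + om ρ z' (om ρ z F) σ = 0 := by
  unfold om
  simp only [iota_fsum]
  rw [Finset.sum_comm (s := Finset.univ.filter (fun v => ρ v = z')), ← Finset.sum_add_distrib]
  refine Finset.sum_eq_zero fun v _ => ?_
  rw [← Finset.sum_add_distrib]
  exact Finset.sum_eq_zero fun w _ => iota_iota_anti v w F σ

theorem sum_anti_zero {α : Type} [LinearOrder α] (s : Finset α) (a : α → α → k)
    (h1 : ∀ i, a i i = 0) (h2 : ∀ i j, a i j + a j i = 0) : ∑ i ∈ s, ∑ j ∈ s, a i j = 0 := by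
  induction s using Finset.induction_on with
  | empty => simp
  | insert x s hx ih =>
    rw [Finset.sum_insert hx, Finset.sum_insert hx, h1]
    simp only [Finset.sum_insert hx, Finset.sum_add_distrib]
    rw [ih, add_zero, zero_add, ← Finset.sum_add_distrib]
    exact Finset.sum_eq_zero fun i _ => h2 _ _

theorem om_self (ρ : V → V) (z : V) (F : Finset V → k) : om ρ z (om ρ z F) = 0 := by
  funext σ
  unfold om
  simp only [iota_fsum]
  let _ : LinearOrder V := LinearOrder.lift' (Fintype.equivFin V) (Fintype.equivFin V).injective
  exact sum_anti_zero _ (fun i j => iota i (iota j F) σ) (fun i => iota_iota_self i F σ)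
    (fun i j => iota_iota_anti i j F σ)

/-- Iterated contraction. -/
noncomputable def Om (ρ : V → V) : List V → (Finset V → k) → (Finset V → k)
  | [], F => F
  | z :: l, F => Om ρ l (om ρ z F)

theorem Om_add (ρ : V → V) (l : List V) (F G : Finset V → k) :
    Om ρ l (F + G) = Om ρ l F + Om ρ l G := by
  induction l generalizing F G with
  | nil => rfl
  | cons a l ih => simp only [Om]; rw [om_add, ih]

theorem Om_zero (ρ : V → V) (l : List V) : Om ρ l (0 : Finset V → k) = 0 := by
  have := Om_add (k := k) ρ l 0 0
  simpa using this

theorem Om_om (ρ : V → V) (l : List V) (z : V) (hz : z ∈ l) (F : Finset V → k) :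
    Om ρ l (om ρ z F) = 0 := by
  induction l generalizing F with
  | nil => simp at hz
  | cons a l ih =>
    simp only [Om]
    by_cases h : z = a
    · subst h; rw [om_self, Om_zero]
    · have hz' : z ∈ l := by simpa [h] using hz
      have h1 : om ρ a (om ρ z F) + om ρ z (om ρ a F) = 0 := funext fun σ => om_om ρ a z F σ
      have h2 := Om_add ρ l (om ρ a (om ρ z F)) (om ρ z (om ρ a F))
      rw [h1, Om_zero, ih hz', add_zero] at h2
      exact h2.symm

theorem Om_fsum (ρ : V → V) (l : List V) (s : Finset V) (F : V → Finset V → k)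
    (h : ∀ z ∈ s, Om ρ l (F z) = 0) : Om ρ l (∑ z ∈ s, F z) = 0 := by
  induction s using Finset.induction_on with
  | empty => simp [Om_zero]
  | insert a s ha ih =>
    rw [Finset.sum_insert ha, Om_add, h a (Finset.mem_insert_self _ _),
      ih (fun z hz => h z (Finset.mem_insert_of_mem hz)), add_zero]

theorem Om_kd (ρ : V → V) (Z : Finset V) (hρ : ∀ v, ρ v ∈ Z) (b : V →₀ ℕ)
    (g : Finset V → MvPolynomial V k) : Om ρ Z.toList (CC b (kd k g)) = 0 := by
  have h : CC b (kd k g) = ∑ z ∈ Z, om ρ z (CC b g) := by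
    funext σ
    rw [CC_kd, Finset.sum_apply]
    unfold om
    rw [Finset.sum_fiberwise_of_maps_to (fun v _ => hρ v)]
  rw [h]
  exact Om_fsum _ _ _ _ fun z hz => Om_om _ _ _ (Finset.mem_toList.2 hz) _

theorem Om_supp (ρ : V → V) (l : List V) (F : Finset V → k)
    (h : ∀ σ, (∀ z ∈ l, ∃ w ∈ σ, ρ w = z) → F σ = 0) : Om ρ l F ∅ = 0 := by
  induction l generalizing F with
  | nil => exact h ∅ (by simp)
  | cons a l ih =>
    simp only [Om]
    refine ih _ fun σ hσ => ?_
    refine Finset.sum_eq_zero fun v hv => ?_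
    rw [Finset.mem_filter] at hv
    unfold iota
    split_ifs
    · rfl
    · rw [h, smul_zero]
      intro z hz
      rw [List.mem_cons] at hz
      rcases hz with rfl | hz
      · exact ⟨v, Finset.mem_insert_self _ _, hv.2⟩
      · obtain ⟨w, hw, hw'⟩ := hσ z hz
        exact ⟨w, Finset.mem_insert_of_mem hw, hw'⟩

theorem om_delta (ρ : V → V) (A : Finset V) (hA : ∀ v ∈ A, ρ v = v) (z : V) (hz : z ∈ A) (c : k) :
    om ρ z (fun σ => if σ = A then c else 0) =
      fun σ => if σ = A.erase z then eps z (A.erase z) • c else 0 := by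
  funext σ
  unfold om
  rw [Finset.sum_eq_single z]
  · simp only [iota]
    by_cases h : z ∈ σ
    · rw [if_pos h, if_neg]
      rintro rfl
      simp at h
    · rw [if_neg h]
      by_cases h1 : σ = A.erase z
      · subst h1
        rw [if_pos rfl, if_pos (Finset.insert_erase hz)]
      · rw [if_neg h1, if_neg, smul_zero]
        rintro rfl
        exact h1 (Finset.erase_insert h).symm
  · intro v hv hvz
    rw [Finset.mem_filter] at hv
    simp only [iota]
    split_ifs with h1 h2
    · rfl
    · exfalso
      have := hA v (by rw [← h2]; exact Finset.mem_insert_self _ _)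
      exact hvz (this.symm.trans hv.2)
    · simp
  · intro h
    exfalso
    exact h (by simp [hA z hz])

theorem Om_delta (ρ : V → V) (l : List V) (hl : l.Nodup) (hρ : ∀ v ∈ l, ρ v = v) (c : k)
    (hc : c ≠ 0) : Om ρ l (fun σ => if σ = l.toFinset then c else 0) ∅ ≠ 0 := by
  induction l generalizing c with
  | nil => simpa [Om] using hc
  | cons a l ih =>
    simp only [Om]
    rw [List.nodup_cons] at hl
    rw [om_delta ρ _ (by simpa using hρ) a (by simp)]
    have h1 : (a :: l).toFinset.erase a = l.toFinset := by
      rw [List.toFinset_cons, Finset.erase_insert]; simpa using hl.1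
    rw [h1]
    refine ih hl.2 (fun v hv => hρ v (List.mem_cons_of_mem _ hv)) _ ?_
    intro h0
    apply hc
    have := congrArg (fun x => eps a l.toFinset • x) h0
    simpa only [smul_smul, eps_sq, one_smul, smul_zero] using this

/-- The abstract lower bound. -/
theorem lower_abs (ρ : V → V) (Z : Finset V) (hρ : ∀ v, ρ v ∈ Z) (hρ' : ∀ z ∈ Z, ρ z = z)
    (b0 : V →₀ ℕ) (U : Set (V →₀ ℕ)) (I : Ideal (MvPolynomial V k))
    (hI : ∀ p, p ∈ I ↔ SIn U p) (hcyc : ∀ z ∈ Z, b0 + Finsupp.single z 1 ∈ U)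
    (hU : ∀ σ, ind σ ≤ b0 + ind Z → (∀ z ∈ Z, ∃ w ∈ σ, ρ w = z) → b0 + ind Z - ind σ ∉ U) :
    ¬ Van (⊤ : Submodule (MvPolynomial V k) (MvPolynomial V k ⧸ I)) (grI I) Z.card b0.degree := by
  intro hV
  have hker : ∀ g : Finset V → MvPolynomial V k, ∀ σ,
      kd k (fun τ => Ideal.Quotient.mk I (g τ)) σ = Ideal.Quotient.mk I (kd k g σ) :=
    fun g σ => kd_map (Submodule.mkQ I) g σ
  let f' : Finset V → MvPolynomial V k := fun σ => if σ = Z then monomial b0 1 else 0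
  obtain ⟨g, _, hg⟩ := hV (fun σ => Ideal.Quotient.mk I (f' σ))
    (fun σ hσ => by
      have : σ ≠ Z := by rintro rfl; exact hσ rfl
      simp [f', this])
    (fun _ => trivial)
    (fun σ => by
      refine ⟨f' σ, ?_, rfl⟩
      simp only [f']
      split_ifs
      · intro m hm
        rw [coeff_monomial] at hm
        split_ifs at hm with h
        · subst h; rfl
        · exact absurd rfl hm
      · exact SIn.zero)
    (fun σ => by
      rw [hker, Ideal.Quotient.eq_zero_iff_mem]
      unfold kd
      refine Ideal.sum_mem _ fun v _ => ?_
      unfold iota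
      split_ifs with h1
      · simp
      · rw [smul_comm]
        simp only [f']
        split_ifs with h2
        · refine zsmul_mem ?_ _
          rw [smul_eq_mul, hI]
          intro m hm
          rw [show (X v : MvPolynomial V k) = monomial (Finsupp.single v 1) 1 from rfl,
            monomial_mul, coeff_monomial] at hm
          split_ifs at hm with h
          · rw [← h, add_comm]
            exact hcyc v (by rw [← h2]; exact Finset.mem_insert_self _ _)
          · exact absurd rfl hm
        · simp)
  have hsurj : ∀ τ, ∃ p, Ideal.Quotient.mk I p = g τ := fun τ => Ideal.Quotient.mk_surjective _
  choose g' hg' using hsurj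
  have hD : ∀ σ, SIn U (f' σ - kd k g' σ) := by
    intro σ
    rw [← hI, ← Ideal.Quotient.eq, ← hker, ← hg]
    congr 1
    funext τ
    exact (hg' τ).symm
  let b := b0 + ind Z
  have h1 : CC b f' = CC b (kd k g') + CC b (fun σ => f' σ - kd k g' σ) := by
    funext σ
    rw [Pi.add_apply]
    unfold CC
    split_ifs
    · rw [coeff_sub]; ring
    · ring
  have h2 : CC b f' = fun σ => if σ = Z.toList.toFinset then (1 : k) else 0 := by
    funext σ
    rw [Finset.toList_toFinset]
    unfold CC
    by_cases h : σ = Z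
    · subst h
      rw [if_pos le_add_self, if_pos rfl]
      simp [f', b]
    · simp [f', h]
  have h3 := Om_delta ρ Z.toList (Finset.nodup_toList Z)
    (fun v hv => hρ' v (Finset.mem_toList.1 hv)) (1 : k) one_ne_zero
  rw [← h2, h1, Om_add, Om_kd ρ Z hρ, zero_add] at h3
  apply h3
  refine Om_supp ρ _ _ fun σ hσ => ?_
  unfold CC
  split_ifs with hle
  · by_contra hne
    exact hU σ hle (fun z hz => hσ z (Finset.mem_toList.2 hz)) (hD σ _ hne)
  · rfl

end functional
end PK

namespace PK

section lower
variable {V : Type} [Fintype V] [DecidableEq V] (T : RTree V) {k : Type} [Field k]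

open Classical in
/-- A chosen child of every inner vertex. -/
noncomputable def sel (v : V) : V := if h : ∃ c, c ∈ ch T v then h.choose else v

theorem sel_mem (hp : T.Perfect) {v : V} (h : T.level v < T.height) : sel T v ∈ ch T v := by
  have h1 := exists_ch T hp h
  rw [sel, dif_pos h1]
  exact h1.choose_spec

/-- The chosen leaves. -/
noncomputable def ZZ : Finset V :=
  Finset.univ.filter fun z => T.level z = T.height ∧ sel T (T.parent z) = z

/-- The inner vertices. -/
noncomputable def AA : Finset V := Finset.univ.filter fun v => T.level v < T.height

theorem mem_ZZ {z : V} : z ∈ ZZ T ↔ T.level z = T.height ∧ sel T (T.parent z) = z := by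
  simp [ZZ]

theorem mem_AA {z : V} : z ∈ AA T ↔ T.level z < T.height := by
  simp [AA]

theorem sel_ZZ (hp : T.Perfect) {v : V} (h : T.level v + 1 = T.height) : sel T v ∈ ZZ T := by
  have h1 := sel_mem T hp (v := v) (by omega)
  have h2 := level_ch T h1
  rw [mem_ZZ, ((mem_ch T).1 h1).1]
  exact ⟨by omega, rfl⟩

theorem exists_down (hp : T.Perfect) (n : ℕ) {v : V} (h : T.level v + (n + 1) = T.height) :
    ∃ z ∈ ZZ T, T.parent^[n + 1] z = v := by
  induction n generalizing v with
  | zero =>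
    refine ⟨sel T v, sel_ZZ T hp h, ?_⟩
    exact ((mem_ch T).1 (sel_mem T hp (by omega))).1
  | succ n ih =>
    have h1 := sel_mem T hp (v := v) (by omega)
    have h2 := level_ch T h1
    obtain ⟨z, hz, hz'⟩ := ih (v := sel T v) (by omega)
    refine ⟨z, hz, ?_⟩
    rw [Function.iterate_succ_apply', hz']
    exact ((mem_ch T).1 h1).1

theorem exists_rho (hh : 1 ≤ T.height) (hp : T.Perfect) (v : V) : ∃ z ∈ ZZ T,
    (v ∈ ZZ T → z = v) ∧ (T.level v < T.height → T.parent^[T.height - T.level v] z = v) := by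
  rcases (level_le_height T v).lt_or_eq with h | h
  · obtain ⟨z, hz, hz'⟩ := exists_down T hp (T.height - T.level v - 1) (v := v) (by omega)
    refine ⟨z, hz, fun hv => ?_, fun _ => ?_⟩
    · rw [mem_ZZ] at hv; omega
    · rw [← hz']; congr 2; rw [hz']; omega
  · refine ⟨sel T (T.parent v), sel_ZZ T hp ?_, fun hv => ((mem_ZZ T).1 hv).2, fun h' => by omega⟩
    rw [level_parent]; omega

theorem lower_ord (z1 : V) (hz1 : z1 ∈ ZZ T) (s : ℕ) (σ : Finset V) (m : V →₀ ℕ)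
    (hm : ∀ u, m u + ind σ u ≤ ind (AA T) u + ind (ZZ T) u + s * pth T T.height z1 u)
    (n : ℕ) (v : V) (hn : T.level v + n = T.height)
    (hcov : ∀ z ∈ ZZ T, z ∈ W T n v → ∃ j ≤ n, T.parent^[j] z ∈ σ) :
    ord T n v m ≤ s * (if z1 ∈ W T n v then 1 else 0) := by
  have hlz := ((mem_ZZ T).1 hz1).1
  have hp1 : ∀ (n : ℕ) (v : V), T.level v + n = T.height →
      s * pth T T.height z1 v ≤ s * (if z1 ∈ W T n v then 1 else 0) := by
    intro n v hn
    refine Nat.mul_le_mul_left _ ?_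
    split_ifs with h
    · exact pth_le_one T hlz.ge v
    · rw [pth_eq_zero]
      intro j hj hjv
      have h1 := level_iter T z1 j
      rw [hjv] at h1
      exact h (mem_W_of T (j := n) le_rfl (by rw [← hjv]; congr 2; omega) (by omega))
  have hAZ : ∀ u, ind (AA T) u + ind (ZZ T) u ≤ 1 := by
    intro u
    rw [ind_apply, ind_apply]
    by_cases h1 : u ∈ AA T
    · have h2 : u ∉ ZZ T := by rw [mem_ZZ]; rw [mem_AA] at h1; omega
      rw [if_pos h1, if_neg h2]
    · rw [if_neg h1]; split_ifs <;> omega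
  have hin : ∀ (n : ℕ) (v : V), T.level v + n = T.height → v ∈ σ →
      m v ≤ s * (if z1 ∈ W T n v then 1 else 0) := by
    intro n v hn hv
    have h1 := hm v
    have h2 := hAZ v
    have h3 := hp1 n v hn
    rw [ind_apply σ, if_pos hv] at h1
    omega
  induction n generalizing v with
  | zero =>
    simp only [ord]
    by_cases hz : v ∈ ZZ T
    · obtain ⟨j, hj, hjσ⟩ := hcov v hz (self_mem_W T 0 v)
      obtain rfl : j = 0 := by omega
      exact hin 0 v hn hjσ
    · have h1 := hm v
      have h3 := hp1 0 v hn
      have hA : v ∉ AA T := by rw [mem_AA]; omega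
      rw [ind_apply (AA T), ind_apply (ZZ T), if_neg hA, if_neg hz] at h1
      omega
  | succ n ih =>
    by_cases hv : v ∈ σ
    · exact le_trans (min_le_left _ _) (hin (n + 1) v hn hv)
    · refine le_trans (min_le_right _ _) ?_
      have hc : ∀ c ∈ ch T v, ord T n c m ≤ s * (if z1 ∈ W T n c then 1 else 0) := by
        intro c hc
        have hlc := level_ch T hc
        refine ih c (by omega) fun z hz hzc => ?_
        obtain ⟨j, hj, hjσ⟩ := hcov z hz (W_child_sub T hc hzc)
        refine ⟨j, ?_, hjσ⟩
        by_contra hjn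
        obtain rfl : j = n + 1 := by omega
        obtain ⟨i, hi, hi1, hi2⟩ := mem_W T hzc
        have hlz' := ((mem_ZZ T).1 hz).1
        obtain rfl : i = n := by omega
        rw [Function.iterate_succ_apply', hi1, ((mem_ch T).1 hc).1] at hjσ
        exact hv hjσ
      refine (Finset.sum_le_sum hc).trans ?_
      rw [← Finset.mul_sum]
      refine Nat.mul_le_mul_left _ ?_
      by_cases h1 : ∃ c ∈ ch T v, z1 ∈ W T n c
      · obtain ⟨c, hc, hzc⟩ := h1
        rw [if_pos (W_child_sub T hc hzc), Finset.sum_eq_single c]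
        · rw [if_pos hzc]
        · intro c' hc' hne
          rw [if_neg]
          exact fun h => Finset.disjoint_left.1 (W_disj T hc' hc hne) h hzc
        · intro h; exact absurd hc h
      · push Not at h1
        rw [Finset.sum_eq_zero fun c hc => if_neg (h1 c hc)]
        exact Nat.zero_le _

theorem card_AA : (AA T).card = cnt T T.height T.root := by
  rw [cnt_eq, W_root, level_root, AA, Finset.card_filter]
  simp

theorem US_nsmul {m : V →₀ ℕ} (h : m ∈ US T 1) (n : ℕ) : n • m ∈ US T n := by
  induction n with
  | zero => exact Nat.zero_le _
  | succ n ih => rw [succ_nsmul]; exact US_add T ih h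

theorem Van_lower (hh : 1 ≤ T.height) (hp : T.Perfect) {s : ℕ} (hs : 1 ≤ s) :
    ¬ Van (⊤ : Submodule (MvPolynomial V k)
      (MvPolynomial V k ⧸ (T.pathIdeal k (T.height + 1)) ^ s)) (grI _) (ZZ T).card
      (((T.height + 1) * (s - 1) + cnt T T.height T.root : ℕ) : ℤ) := by
  choose ρ hρ1 hρ2 hρ3 using exists_rho T hh hp
  have hz1 := hρ1 T.root
  generalize ρ T.root = z1 at hz1
  let b0 : V →₀ ℕ := ind (AA T) + (s - 1) • pth T T.height z1
  have hb0 : b0.degree = (T.height + 1) * (s - 1) + cnt T T.height T.root := by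
    simp only [b0]
    rw [map_add, map_nsmul, ind_degree, card_AA, pth_degree, smul_eq_mul]
    ring
  rw [← hb0]
  refine lower_abs ρ (ZZ T) hρ1 (fun z hz => hρ2 z hz) b0 (US T s) _ (fun p => mem_pow_iff T) ?_ ?_
  · intro z hz
    have hlz := ((mem_ZZ T).1 hz).1
    have h1 : pth T T.height z + (s - 1) • pth T T.height z1 ∈ US T (1 + (s - 1)) :=
      US_add T (pth_mem_US T hlz) (US_nsmul T (pth_mem_US T ((mem_ZZ T).1 hz1).1) _)
    rw [show 1 + (s - 1) = s by omega] at h1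
    refine US_upper T s ?_ h1
    have h2 : pth T T.height z ≤ ind (AA T) + Finsupp.single z 1 := by
      intro u
      by_cases hu : ∃ j ≤ T.height, T.parent^[j] z = u
      · refine (pth_le_one T hlz.ge u).trans ?_
        obtain ⟨j, hj, rfl⟩ := hu
        rw [Finsupp.add_apply]
        cases j with
        | zero => simp
        | succ j =>
          rw [ind_apply, if_pos]
          · omega
          · rw [mem_AA, level_iter]; omega
      · push Not at hu
        rw [pth_eq_zero T hu]; exact Nat.zero_le _
    simp only [b0]
    rw [add_right_comm]
    exact add_le_add_left h2 _
  · intro σ hσ hcov hU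
    have hm : ∀ u, (b0 + ind (ZZ T) - ind σ) u + ind σ u ≤
        ind (AA T) u + ind (ZZ T) u + (s - 1) * pth T T.height z1 u := by
      intro u
      have h1 := hσ u
      rw [Finsupp.tsub_apply, Nat.sub_add_cancel h1]
      simp only [b0, Finsupp.add_apply, Finsupp.smul_apply, smul_eq_mul]
      omega
    have h2 := lower_ord T z1 hz1 (s - 1) σ _ hm T.height T.root (by rw [level_root]; omega) (by
      intro z hz _
      obtain ⟨w, hw, hwz⟩ := hcov z hz
      rcases (level_le_height T w).lt_or_eq with h | h
      · refine ⟨T.height - T.level w, by omega, ?_⟩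
        rw [← hwz, hρ3 w h]; exact hw
      · refine ⟨0, Nat.zero_le _, ?_⟩
        have hwZ : w ∈ ZZ T := by
          by_contra hwZ
          have h1 := hσ w
          have hA : w ∉ AA T := by rw [mem_AA]; omega
          simp only [b0, Finsupp.add_apply, Finsupp.smul_apply, smul_eq_mul] at h1
          rw [ind_apply σ, ind_apply, ind_apply, if_pos hw, if_neg hA, if_neg hwZ, pth_eq_zero] at h1
          · omega
          · intro j hj hjw
            have h3 := level_iter T z1 j
            have h4 := ((mem_ZZ T).1 hz1).1
            rw [hjw] at h3
            obtain rfl : j = 0 := by omega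
            exact hwZ (by rw [← hjw]; exact hz1)
        rw [← hwz, hρ2 w hwZ]; exact hw)
    have h3 : s ≤ ord T T.height T.root (b0 + ind (ZZ T) - ind σ) := hU
    have h4 : (s - 1) * (if z1 ∈ W T T.height T.root then 1 else 0) ≤ (s - 1) * 1 :=
      Nat.mul_le_mul_left _ (by split_ifs <;> omega)
    omega

theorem reg_eq (hh : 1 ≤ T.height) (hp : T.Perfect) {s : ℕ} (hs : 1 ≤ s) :
    reg k V ((T.pathIdeal k (T.height + 1)) ^ s) =
      (((T.height + 1) * (s - 1) + cnt T T.height T.root : ℕ) : ℤ) := by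
  have hI := HomI_pow T (k := k) s
  unfold reg
  refine IsGreatest.csSup_eq ⟨?_, ?_⟩
  · obtain ⟨F⟩ := res_exists _ hI (const_pow T hs)
    obtain ⟨j, hj⟩ := (gens_iff F hI _ _).2 (Van_lower T (k := k) hh hp hs)
    exact ⟨F, _, j, by rw [hj]; ring⟩
  · rintro x ⟨F, i, j, rfl⟩
    by_contra hlt
    push Not at hlt
    exact (gens_iff F hI ((F.deg i j : ℤ) - i) i).1 ⟨j, by ring⟩ (Van_upper T hs i _ hlt)

theorem cnt_final (hh : 1 ≤ T.height) : ((cnt T T.height T.root : ℕ) : ℤ) =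
    1 + ∑ x : V, (if T.level x + 2 ≤ T.height then (T.outdeg x : ℤ) else 0) := by
  obtain ⟨n, hn⟩ : ∃ n, T.height = n + 1 := ⟨T.height - 1, by omega⟩
  have h1 := cnt_outdeg T n T.root
  rw [← hn, W_root, level_root, zero_add] at h1
  rw [h1]
  push_cast
  rfl

end lower
end PK

/-- Theorem F: for a perfect rooted tree of height `h ≥ 1` and `t = h + 1`, for all
`s ≥ 1`, `reg(R/I_t(Γ)^s) = t(s-1) + 1 + Σ_{0 ≤ ℓ(x) ≤ h-2} deg⁺(x)
= t(s-1) + reg(R/I_t(Γ))`. -/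
theorem reg_powers_path_ideal_perfect
    {k V : Type} [Field k] [Fintype V] [DecidableEq V] (T : RTree V)
    (hh : 1 ≤ T.height) (hperf : T.Perfect) (s : ℕ) (hs : 1 ≤ s) :
    reg k V ((T.pathIdeal k (T.height + 1)) ^ s) =
        (((T.height + 1) * (s - 1) : ℕ) : ℤ) + 1 +
          ∑ x : V, (if T.level x + 2 ≤ T.height then (T.outdeg x : ℤ) else 0) ∧
    reg k V ((T.pathIdeal k (T.height + 1)) ^ s) =
        (((T.height + 1) * (s - 1) : ℕ) : ℤ) + reg k V (T.pathIdeal k (T.height + 1)) := by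
  have h1 := PK.reg_eq T (k := k) hh hperf hs
  have h2 := PK.reg_eq T (k := k) hh hperf le_rfl
  rw [pow_one] at h2
  rw [h1, h2]
  constructor
  · rw [Nat.cast_add, PK.cnt_final T hh]; ring
  · push_cast; ring
end

section
/- Let u, v ∈ k[x_1,...,x_n] be monomials in disjoint sets of variables, each of degree at least 2, and let m be any monomial coprime to uv. Then for every s ≥ 1, the ideal (mu, mv)^s does not have a linear resolution. -/
open MvPolynomial

/-- The ideal `I`, equigenerated in some degree `t`, has a linear resolution:
`β_{i,j}(I) = 0` for `j ≠ t + i`.  (In a minimal free resolution of `R/I`, homological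
degree `i+1` records the Betti numbers `β_{i,j}(I)` of the ideal.) -/
def HasLinearResolution (k σ : Type) [Field k] (I : Ideal (MvPolynomial σ k)) : Prop :=
  ∃ t : ℕ, ∀ F : MinFreeRes k σ I, ∀ i : ℕ, ∀ j : Fin (F.b (i + 1)),
    F.deg (i + 1) j = t + i

/-- Powers of a two-generated ideal. -/
theorem span_pair_pow_aux {R : Type} [CommRing R] (p q : R) (s : ℕ) :
    (Ideal.span {p, q}) ^ s =
      Ideal.span (Set.range fun i : Fin (s + 1) => p ^ (s - (i : ℕ)) * q ^ (i : ℕ)) := by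
  apply le_antisymm
  · induction s with
    | zero =>
      have h : (1 : R) ∈ Ideal.span (Set.range
          fun i : Fin (0 + 1) => p ^ (0 - (i : ℕ)) * q ^ (i : ℕ)) :=
        Ideal.subset_span ⟨0, by simp⟩
      rw [(Ideal.eq_top_iff_one _).2 h]
      exact le_top
    | succ s ih =>
      rw [pow_succ']
      refine (Ideal.mul_mono_right ih).trans ?_
      rw [Ideal.span_mul_span', Ideal.span_le]
      rintro _ ⟨x, hx, _, ⟨i, rfl⟩, rfl⟩
      apply Ideal.subset_span
      have hi := i.2
      rcases hx with rfl | rfl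
      · refine ⟨⟨i, by omega⟩, ?_⟩
        have : s + 1 - (i : ℕ) = (s - i) + 1 := by omega
        simp only [this]
        ring
      · refine ⟨⟨i + 1, by omega⟩, ?_⟩
        have : s + 1 - ((i : ℕ) + 1) = (s - i) := by omega
        simp only [this]
        ring
  · rw [Ideal.span_le]
    rintro _ ⟨i, rfl⟩
    have hp : p ∈ Ideal.span {p, q} := Ideal.subset_span (by simp)
    have hq : q ∈ Ideal.span {p, q} := Ideal.subset_span (by simp)
    have h := Ideal.mul_mem_mul (Ideal.pow_mem_pow hp (s - i)) (Ideal.pow_mem_pow hq i)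
    rw [← pow_add, Nat.sub_add_cancel (Nat.lt_succ_iff.1 i.2)] at h
    exact h

theorem syz_aux {R : Type} [CommRing R] [IsDomain R] (u v : R) (hu : u ≠ 0)
    (h : ∀ x, u ∣ v * x → u ∣ x) (s : ℕ) : ∀ e : ℕ → R,
    ∑ i ∈ Finset.range (s + 1), e i * (u ^ (s - i) * v ^ i) = 0 →
    ∃ f : ℕ → R, f 0 = 0 ∧ f (s + 1) = 0 ∧ ∀ i, i ≤ s → e i = v * f (i + 1) - u * f i := by
  have hpow : ∀ n x, u ∣ v ^ n * x → u ∣ x := by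
    intro n
    induction n with
    | zero => intro x hx; simpa using hx
    | succ n ih => intro x hx; rw [pow_succ', mul_assoc] at hx; exact ih x (h _ hx)
  induction s with
  | zero =>
    intro e he
    refine ⟨fun _ => 0, rfl, rfl, ?_⟩
    intro i hi
    obtain rfl : i = 0 := by omega
    simpa using he
  | succ s ih =>
    intro e he
    have key : ∑ i ∈ Finset.range (s + 1), e i * (u ^ (s + 1 - i) * v ^ i)
        = u * ∑ i ∈ Finset.range (s + 1), e i * (u ^ (s - i) * v ^ i) := by
      rw [Finset.mul_sum]
      apply Finset.sum_congr rfl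
      intro i hi
      have : s + 1 - i = (s - i) + 1 := by have := Finset.mem_range.1 hi; omega
      rw [this]; ring
    rw [Finset.sum_range_succ, key] at he
    simp only [Nat.sub_self, pow_zero, one_mul] at he
    have hd : u ∣ e (s + 1) := by
      apply hpow (s + 1)
      refine ⟨-∑ i ∈ Finset.range (s + 1), e i * (u ^ (s - i) * v ^ i), ?_⟩
      linear_combination he
    obtain ⟨g, hg⟩ := hd
    have h0 : ∑ i ∈ Finset.range (s + 1),
        (fun i => if i = s then e s + v * g else e i) i * (u ^ (s - i) * v ^ i) = 0 := by
      apply mul_left_cancel₀ hu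
      rw [mul_zero, ← he, Finset.sum_range_succ, Finset.sum_range_succ]
      have : ∑ i ∈ Finset.range s,
        (fun i => if i = s then e s + v * g else e i) i * (u ^ (s - i) * v ^ i)
        = ∑ i ∈ Finset.range s, e i * (u ^ (s - i) * v ^ i) := by
        apply Finset.sum_congr rfl
        intro i hi
        have : i ≠ s := by have := Finset.mem_range.1 hi; omega
        simp [this]
      rw [this]
      generalize ∑ i ∈ Finset.range s, e i * (u ^ (s - i) * v ^ i) = S
      simp only [if_true, hg, Nat.sub_self, pow_zero]
      ring
    obtain ⟨f, f0, f1, hf⟩ := ih _ h0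
    refine ⟨fun i => if i = s + 1 then -g else if i = s + 2 then 0 else f i, by simp [f0],
      by simp, ?_⟩
    intro i hi
    rcases Nat.lt_trichotomy i s with h1 | h1 | h1
    · have := hf i (by omega)
      simp only [show i ≠ s by omega, if_false] at this
      simp only [show i + 1 ≠ s + 1 by omega, show i ≠ s + 1 by omega, show i + 1 ≠ s + 2 by omega,
        show i ≠ s + 2 by omega, if_false]
      exact this
    · subst h1
      have := hf i le_rfl
      simp only [if_true, f1] at this
      simp
      linear_combination this
    · obtain rfl : i = s + 1 := by omega
      simp [hg]

theorem monomial_dvd_aux {k σ : Type} [Field k] (b c : σ →₀ ℕ)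
    (hdisj : Disjoint b.support c.support) (x : MvPolynomial σ k)
    (h : monomial b (1 : k) ∣ monomial c (1 : k) * x) : monomial b (1 : k) ∣ x := by
  have e : ∀ y : MvPolynomial σ k, monomial b (1 : k) ∣ y ↔ ∀ d ∈ y.support, b ≤ d := by
    intro y
    have := mem_ideal_span_monomial_image (R := k) (x := y) (s := {b})
    rw [Set.image_singleton, Ideal.mem_span_singleton] at this
    simpa using this
  rw [e] at h ⊢
  intro d hd
  have h1 := h (c + d) (by
    rw [mem_support_iff, coeff_monomial_mul, one_mul]; exact mem_support_iff.1 hd)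
  intro i
  by_cases hi : i ∈ b.support
  · have hc : c i = 0 := Finsupp.notMem_support_iff.1 (Finset.disjoint_left.1 hdisj hi)
    have := h1 i
    simpa [hc] using this
  · simp [Finsupp.notMem_support_iff.1 hi]

/-- extension of a vector by zero, shifted by one -/
def extF {R : Type} [CommRing R] {s : ℕ} (f : Fin s → R) (n : ℕ) : R :=
  if h : 0 < n ∧ n ≤ s then f ⟨n - 1, by omega⟩ else 0

theorem extF_succ {R : Type} [CommRing R] {s : ℕ} (f : Fin s → R) (j : Fin s) :
    extF f ((j : ℕ) + 1) = f j := by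
  have := j.2
  simp [extF]

theorem extF_single {R : Type} [CommRing R] {s : ℕ} (j : Fin s) (n : ℕ) :
    extF (Pi.single j (1 : R)) n = if n = j + 1 then 1 else 0 := by
  have := j.2
  unfold extF
  split_ifs with h1 h2 h2
  · subst h2; simp
  · rw [Pi.single_eq_of_ne]; intro h; apply h2; rw [← h]; simp; omega
  · omega
  · rfl

def rk (s : ℕ) : ℕ → ℕ
  | 0 => 1
  | 1 => s + 1
  | 2 => s
  | _ + 3 => 0

def dg (s A B C : ℕ) : (i : ℕ) → Fin (rk s i) → ℕ
  | 0, _ => 0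
  | 1, i => (s - (Fin.val (n := s + 1) i)) * (A + B) + (Fin.val (n := s + 1) i) * (A + C)
  | 2, i => (s - (Fin.val (n := s) i)) * (A + B) + (Fin.val (n := s) i) * (A + C) + C
  | _ + 3, _ => 0

noncomputable def d0 {R : Type} [CommRing R] (s : ℕ) (p q : R) :
    (Fin (s + 1) → R) →ₗ[R] (Fin 1 → R) where
  toFun e := fun _ => ∑ i, e i * (p ^ (s - (i : ℕ)) * q ^ (i : ℕ))
  map_add' e f := by ext; simp [add_mul, Finset.sum_add_distrib]
  map_smul' r e := by ext; simp [Finset.mul_sum, mul_assoc]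

noncomputable def d1 {R : Type} [CommRing R] (s : ℕ) (u v : R) :
    (Fin s → R) →ₗ[R] (Fin (s + 1) → R) where
  toFun f := fun i => v * extF f ((i : ℕ) + 1) - u * extF f i
  map_add' e f := by
    ext i
    simp only [extF, Pi.add_apply]
    split_ifs <;> ring
  map_smul' r e := by
    ext i
    simp only [extF, Pi.smul_apply, smul_eq_mul, RingHom.id_apply]
    split_ifs <;> ring

noncomputable def dd {R : Type} [CommRing R] (s : ℕ) (m u v : R) :
    (i : ℕ) → ((Fin (rk s (i + 1)) → R) →ₗ[R] (Fin (rk s i) → R))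
  | 0 => d0 s (m * u) (m * v)
  | 1 => d1 s u v
  | _ + 2 => 0

theorem exact_dd {R : Type} [CommRing R] [IsDomain R] (s : ℕ) (m u v : R)
    (hm : m ≠ 0) (hu : u ≠ 0) (hv : v ≠ 0) (h : ∀ x, u ∣ v * x → u ∣ x) (i : ℕ) :
    Function.Exact (dd s m u v (i + 1)) (dd s m u v i) := by
  match i with
  | 0 =>
    change Function.Exact (d1 s u v) (d0 s (m * u) (m * v))
    intro e
    have hfac : ∀ e : Fin (s + 1) → R,
        ∑ i, e i * ((m * u) ^ (s - (i : ℕ)) * (m * v) ^ (i : ℕ)) = m ^ s * ∑ i ∈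
        Finset.range (s + 1), (if hi : i < s + 1 then e ⟨i, hi⟩ else 0) * (u ^ (s - i) * v ^ i) := by
      intro e
      rw [Finset.sum_range, Finset.mul_sum]
      apply Finset.sum_congr rfl
      intro i _
      have h2 : s = (s - (i : ℕ)) + i := by have := i.2; omega
      have h3 : m ^ s = m ^ (s - (i : ℕ)) * m ^ (i : ℕ) := by rw [← pow_add, ← h2]
      rw [h3, dif_pos i.2]
      ring
    constructor
    · intro he
      have he := congrFun he 0
      change ∑ i, e i * ((m * u) ^ (s - (i : ℕ)) * (m * v) ^ (i : ℕ)) = 0 at he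
      rw [hfac] at he
      have he := (mul_eq_zero.1 he).resolve_left (pow_ne_zero _ hm)
      obtain ⟨f, f0, f1, hf⟩ := syz_aux u v hu h s _ he
      have hx : ∀ n, n ≤ s + 1 → extF (fun j : Fin s => f (j + 1)) n = f n := by
        intro n hn
        unfold extF
        split_ifs with h1
        · simp only; congr 1; omega
        · have : n = 0 ∨ n = s + 1 := by omega
          rcases this with rfl | rfl
          · exact f0.symm
          · exact f1.symm
      refine ⟨fun j => f (j + 1), ?_⟩
      ext i
      change v * extF _ ((i : ℕ) + 1) - u * extF _ i = e i
      have hi := i.2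
      rw [hx _ (by omega), hx _ (by omega), ← hf i (by omega), dif_pos hi]
    · rintro ⟨f, rfl⟩
      ext z
      change ∑ i : Fin (s + 1), (v * extF f ((i : ℕ) + 1) - u * extF f i) *
        ((m * u) ^ (s - (i : ℕ)) * (m * v) ^ (i : ℕ)) = 0
      rw [hfac (fun i => v * extF f ((i : ℕ) + 1) - u * extF f i)]
      have : ∀ i ∈ Finset.range (s + 1), (if hi : i < s + 1 then
          v * extF f (i + 1) - u * extF f i else 0) * (u ^ (s - i) * v ^ i) =
          (fun i => extF f i * (u ^ (s + 1 - i) * v ^ i)) (i + 1) -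
          (fun i => extF f i * (u ^ (s + 1 - i) * v ^ i)) i := by
        intro i hi
        have hi := Finset.mem_range.1 hi
        have h2 : s + 1 - i = (s - i) + 1 := by omega
        simp only [hi, dif_pos, h2, Nat.add_sub_add_right]
        ring
      simp only at this ⊢
      rw [Finset.sum_congr rfl this, Finset.sum_range_sub (fun i => extF f i * (u ^ (s + 1 - i) * v ^ i))]
      simp [extF]
  | 1 =>
    change Function.Exact (0 : (Fin 0 → R) →ₗ[R] (Fin s → R)) (d1 s u v)
    intro f
    constructor
    · intro hf
      have hz : ∀ n, n ≤ s → extF f n = 0 := by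
        intro n
        induction n with
        | zero => intro _; simp [extF]
        | succ n ih =>
          intro hn
          have := congrFun hf ⟨n, by omega⟩
          change v * extF f (n + 1) - u * extF f n = 0 at this
          rw [ih (by omega), mul_zero, sub_zero] at this
          exact (mul_eq_zero.1 this).resolve_left hv
      refine ⟨0, ?_⟩
      ext j
      have := hz (j + 1) j.2
      rw [extF_succ] at this
      exact this.symm
    · rintro ⟨f, rfl⟩
      exact map_zero (d1 s u v)
  | i + 2 =>
    intro f
    have : f = 0 := by
      ext j
      exact Fin.elim0 j
    subst this
    exact ⟨fun _ => ⟨0, map_zero _⟩, fun _ => map_zero _⟩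

theorem degree_pos_const {k σ : Type} [Field k] (b : σ →₀ ℕ) (hb : b ≠ 0) :
    constantCoeff (monomial b (1 : k)) = 0 := by
  classical
  rw [constantCoeff_eq, coeff_monomial, if_neg hb]

noncomputable def theRes (k σ : Type) [Field k] (a b c : σ →₀ ℕ) (hb : b ≠ 0) (hc : c ≠ 0)
    (hdisj : Disjoint b.support c.support) (s : ℕ) (hs : 1 ≤ s) :
    MinFreeRes k σ ((Ideal.span {monomial (a + b) (1 : k), monomial (a + c) (1 : k)}) ^ s) where
  b := rk s
  deg := dg s a.degree b.degree c.degree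
  d := dd s (monomial a (1 : k)) (monomial b (1 : k)) (monomial c (1 : k))
  aug := (Ideal.Quotient.mkₐ (MvPolynomial σ k) _).toLinearMap ∘ₗ
    (LinearMap.proj (0 : Fin 1))
  aug_surjective := by
    intro y
    obtain ⟨x, rfl⟩ := Ideal.Quotient.mk_surjective y
    exact ⟨fun _ => x, rfl⟩
  exact_zero := by
    intro x
    have hx : ((Ideal.Quotient.mkₐ (MvPolynomial σ k) ((Ideal.span {monomial (a + b) (1 : k),
      monomial (a + c) (1 : k)}) ^ s)).toLinearMap ∘ₗ
      (LinearMap.proj (0 : Fin 1) : (Fin 1 → MvPolynomial σ k) →ₗ[MvPolynomial σ k] _)) x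
        = Ideal.Quotient.mk _ (x (0 : Fin 1)) := rfl
    refine (Eq.congr_left hx).trans ?_
    rw [Ideal.Quotient.eq_zero_iff_mem, span_pair_pow_aux, Ideal.mem_span_range_iff_exists_fun]
    have h1 : monomial (a + b) (1 : k) = monomial a 1 * monomial b 1 := by simp
    have h2 : monomial (a + c) (1 : k) = monomial a 1 * monomial c 1 := by simp
    rw [h1, h2]
    constructor
    · rintro ⟨e, he⟩
      refine ⟨e, ?_⟩
      funext z
      obtain rfl : z = (0 : Fin 1) := Subsingleton.elim (α := Fin 1) _ _
      exact he
    · rintro ⟨e, rfl⟩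
      exact ⟨e, rfl⟩
  exact_succ := by
    apply exact_dd
    · simp
    · simp
    · simp
    · exact monomial_dvd_aux b c hdisj
  aug_homog := by
    intro j
    obtain rfl : j = (0 : Fin 1) := Subsingleton.elim (α := Fin 1) _ _
    refine ⟨1, isHomogeneous_one _ _, ?_⟩
    change Ideal.Quotient.mk _ ((Pi.single (0 : Fin 1) (1 : MvPolynomial σ k) :
      Fin 1 → MvPolynomial σ k) 0) = _
    simp
  d_homog := by
    intro i j l
    have ha' : (monomial a (1 : k)).IsHomogeneous a.degree := isHomogeneous_monomial _ rfl
    have hb' : (monomial b (1 : k)).IsHomogeneous b.degree := isHomogeneous_monomial _ rfl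
    have hc' : (monomial c (1 : k)).IsHomogeneous c.degree := isHomogeneous_monomial _ rfl
    match i with
    | 0 =>
      refine ⟨?_, fun h => absurd h (Nat.not_lt_zero _)⟩
      change Fin (s + 1) at j
      change (∑ i, (Pi.single j 1 : Fin (s + 1) → MvPolynomial σ k) i *
        ((monomial a (1 : k) * monomial b (1 : k)) ^ (s - (i : ℕ)) *
          (monomial a (1 : k) * monomial c (1 : k)) ^ (i : ℕ))).IsHomogeneous
          ((s - (j : ℕ)) * (a.degree + b.degree) + (j : ℕ) * (a.degree + c.degree))
      rw [Finset.sum_eq_single j (by intro i _ hi; simp [hi]) (by simp)]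
      rw [Pi.single_eq_same, one_mul, mul_comm (s - (j : ℕ)), mul_comm (j : ℕ)]
      exact ((ha'.mul hb').pow _).mul ((ha'.mul hc').pow _)
    | 1 =>
      change Fin s at j
      change Fin (s + 1) at l
      change (monomial c (1 : k) * extF (Pi.single j 1) ((l : ℕ) + 1)
        - monomial b (1 : k) * extF (Pi.single j 1) l).IsHomogeneous
        (((s - (j : ℕ)) * (a.degree + b.degree) + (j : ℕ) * (a.degree + c.degree) + c.degree) -
         ((s - (l : ℕ)) * (a.degree + b.degree) + (l : ℕ) * (a.degree + c.degree))) ∧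
        (((s - (j : ℕ)) * (a.degree + b.degree) + (j : ℕ) * (a.degree + c.degree) + c.degree) <
         ((s - (l : ℕ)) * (a.degree + b.degree) + (l : ℕ) * (a.degree + c.degree)) →
         monomial c (1 : k) * extF (Pi.single j 1) ((l : ℕ) + 1)
          - monomial b (1 : k) * extF (Pi.single j 1) l = 0)
      rw [extF_single, extF_single]
      have hj := j.2
      by_cases h1 : (l : ℕ) = j
      · rw [if_pos (by omega), if_neg (by omega), h1]
        simp only [mul_one, mul_zero, sub_zero]
        refine ⟨by rw [Nat.add_sub_cancel_left]; exact hc', fun h => absurd h (by omega)⟩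
      · rw [if_neg (by omega)]
        by_cases h2 : (l : ℕ) = j + 1
        · rw [if_pos h2, h2]
          have h3 : s - (j : ℕ) = (s - (j + 1)) + 1 := by omega
          have h4 : (s - (j : ℕ)) * (a.degree + b.degree) + (j : ℕ) * (a.degree + c.degree)
              + c.degree = ((s - ((j : ℕ) + 1)) * (a.degree + b.degree) +
              ((j : ℕ) + 1) * (a.degree + c.degree)) + b.degree := by
            rw [h3]; ring
          rw [h4, Nat.add_sub_cancel_left]
          refine ⟨?_, fun h => absurd h (by omega)⟩
          simp only [mul_one, mul_zero, zero_sub]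
          exact hb'.neg
        · rw [if_neg h2]
          simp only [mul_zero, sub_zero]
          exact ⟨isHomogeneous_zero _ _ _, fun _ => trivial⟩
    | i + 2 => exact Fin.elim0 j
  minimal := by
    intro i j l
    match i with
    | 0 =>
      change Fin (s + 1) at j
      change constantCoeff (∑ i, (Pi.single j 1 : Fin (s + 1) → MvPolynomial σ k) i *
        ((monomial a (1 : k) * monomial b (1 : k)) ^ (s - (i : ℕ)) *
          (monomial a (1 : k) * monomial c (1 : k)) ^ (i : ℕ))) = 0
      rw [Finset.sum_eq_single j (by intro i _ hi; simp [hi]) (by simp)]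
      simp only [map_mul, map_pow, degree_pos_const _ hb, degree_pos_const _ hc, mul_zero]
      by_cases h : (j : ℕ) = 0
      · rw [h, Nat.sub_zero, zero_pow (by omega)]; simp
      · rw [zero_pow h]; simp
    | 1 =>
      change constantCoeff (monomial c (1 : k) * extF (Pi.single _ 1) _
        - monomial b (1 : k) * extF (Pi.single _ 1) _) = 0
      simp only [map_mul, map_sub, degree_pos_const _ hb, degree_pos_const _ hc, zero_mul, sub_zero]
    | i + 2 => exact Fin.elim0 j

/-- Let `u = x^b`, `v = x^c` be monomials in disjoint sets of variables, each of degree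
at least 2, and let `m = x^a` be a monomial coprime to `uv`. Then for every `s ≥ 1` the
ideal `(mu, mv)^s` does not have a linear resolution. -/
theorem power_no_linear_resolution
    {k σ : Type} [Field k] [Fintype σ] [DecidableEq σ]
    (a b c : σ →₀ ℕ)
    (hb : 2 ≤ b.sum fun _ e => e) (hc : 2 ≤ c.sum fun _ e => e)
    (hdisj : Disjoint b.support c.support)
    (hcop : Disjoint a.support (b.support ∪ c.support))
    (s : ℕ) (hs : 1 ≤ s) :
    ¬ HasLinearResolution k σ
        ((Ideal.span {monomial (a + b) (1 : k), monomial (a + c) (1 : k)}) ^ s) := by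
  rintro ⟨t, ht⟩
  have hb0 : b ≠ 0 := by rintro rfl; simp at hb
  have hc0 : c ≠ 0 := by rintro rfl; simp at hc
  have h1 := ht (theRes k σ a b c hb0 hc0 hdisj s hs) 0 (⟨0, by omega⟩ : Fin (s + 1))
  have h2 := ht (theRes k σ a b c hb0 hc0 hdisj s hs) 1 (⟨0, by omega⟩ : Fin s)
  change (s - 0) * (a.degree + b.degree) + 0 * (a.degree + c.degree) = t + 0 at h1
  change (s - 0) * (a.degree + b.degree) + 0 * (a.degree + c.degree) + c.degree = t + 1 at h2
  have h3 : c.degree = c.sum fun _ e => e := rfl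
  omega
end
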